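/- arXiv:1706.02340 — 2 statements merged into one kernel-verified Lean document; each statement's English description precedes it below -/
import Mathlib

section
/- Let p be a prime and let G be a non-abelian finite p-group of order p^n with commutator subgroup G' of order p^k, and let d = d(G). If |M(G)| attains the bound, i.e. |M(G)| = p^{(1/2)(d-1)(n+k-2)+1}, then the abelianization G/G' is homocyclic; more precisely, there exists an integer e ≥ 1 such that G/G' is isomorphic to the direct product of d copies of the cyclic group Z/p^e Z. -/
/-- The minimal number of elements required to generate a group `G`. -/
noncomputable def minGens (G : Type*) [Group G] : ℕ :=
  sInf {n | ∃ S : Finset G, S.card = n ∧ Subgroup.closure (S : Set G) = ⊤}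

/-- The cardinality of the Hopf quotient `(R ∩ [F,F]) / [R,F]` associated to a
presentation `π : F → G` with kernel `R = ker π`. -/
noncomputable def hopfCard {F G : Type*} [Group F] [Group G] (π : F →* G) : ℕ :=
  Nat.card ((π.ker ⊓ commutator F : Subgroup F) ⧸
    (⁅π.ker, (⊤ : Subgroup F)⁆.subgroupOf (π.ker ⊓ commutator F)))

/-- The order of the Schur multiplier `M(G)`, computed by Hopf's formula from the
canonical free presentation `FreeGroup G → G`. -/
noncomputable def schurCard (G : Type*) [Group G] : ℕ :=
  hopfCard (FreeGroup.lift (id : G → G))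


open scoped commutatorElement

namespace SchurAux

lemma card_le_of_closure {A ι : Type*} [CommGroup A] [Fintype ι] (t : ι → A) (m : ι → ℕ)
    (hm : ∀ i, 0 < m i) (ht : ∀ i, t i ^ m i = 1) (H : Subgroup A)
    (hH : H ≤ Subgroup.closure (Set.range t)) : Finite H ∧ Nat.card H ≤ ∏ i, m i := by
  classical
  have key : ∀ x ∈ Subgroup.closure (Set.range t), ∃ z : ι → ℤ, x = ∏ i, t i ^ z i := by
    intro x hx
    induction hx using Subgroup.closure_induction with
    | mem x hx =>
      obtain ⟨i, rfl⟩ := hx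
      refine ⟨Pi.single i 1, ?_⟩
      rw [Finset.prod_eq_single i]
      · simp
      · intro j _ hj; simp [hj]
      · simp
    | one => exact ⟨0, by simp⟩
    | mul x y _ _ hx hy =>
      obtain ⟨z, rfl⟩ := hx
      obtain ⟨w, rfl⟩ := hy
      exact ⟨z + w, by simp [zpow_add, Finset.prod_mul_distrib]⟩
    | inv x _ hx =>
      obtain ⟨z, rfl⟩ := hx
      exact ⟨-z, by simp⟩
  let f : (∀ i, Fin (m i)) → A := fun g => ∏ i, t i ^ (g i : ℕ)
  have hsub : (H : Set A) ⊆ Set.range f := by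
    intro x hx
    obtain ⟨z, rfl⟩ := key x (hH hx)
    refine ⟨fun i => ⟨(z i % m i).toNat, ?_⟩, ?_⟩
    · have h1 := Int.emod_lt_of_pos (z i) (Int.natCast_pos.mpr (hm i))
      have h2 := Int.emod_nonneg (z i) (Int.natCast_pos.mpr (hm i)).ne'
      omega
    · refine Finset.prod_congr rfl fun i _ => ?_
      have h2 := Int.emod_nonneg (z i) (Int.natCast_pos.mpr (hm i)).ne'
      rw [← zpow_natCast]
      simp only [Int.toNat_of_nonneg h2]
      conv_rhs => rw [← Int.emod_add_mul_ediv (z i) (m i)]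
      rw [zpow_add, zpow_mul, zpow_natCast, ht i, one_zpow, mul_one]
  refine ⟨(Set.finite_range f).subset hsub, ?_⟩
  calc Nat.card H ≤ Nat.card (Set.range f) := Nat.card_mono (Set.finite_range f) hsub
    _ ≤ Nat.card (∀ i, Fin (m i)) := Finite.card_range_le f
    _ = ∏ i, m i := by simp

/-- noncommutative version: family of central elements -/
lemma card_le_of_closure_center {Q ι : Type*} [Group Q] [Fintype ι] (t : ι → Q) (m : ι → ℕ)
    (hc : ∀ i, t i ∈ Subgroup.center Q)
    (hm : ∀ i, 0 < m i) (ht : ∀ i, t i ^ m i = 1) (H : Subgroup Q)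
    (hH : H ≤ Subgroup.closure (Set.range t)) : Nat.card H ≤ ∏ i, m i := by
  let t' : ι → Subgroup.center Q := fun i => ⟨t i, hc i⟩
  have h0 : Subgroup.closure (Set.range t) =
      (Subgroup.closure (Set.range t')).map (Subgroup.center Q).subtype := by
    rw [MonoidHom.map_closure, ← Set.range_comp]; rfl
  let _ : CommGroup (Subgroup.center Q) :=
    { (inferInstance : Group (Subgroup.center Q)) with
      mul_comm := fun a b => Subtype.ext (Subgroup.mem_center_iff.1 b.2 a) }
  have h1 := card_le_of_closure t' m hm (fun i => Subtype.ext (by simpa [t'] using ht i)) _ le_rfl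
  have hle : H ≤ (Subgroup.closure (Set.range t')).map (Subgroup.center Q).subtype := h0 ▸ hH
  have : Finite (Subgroup.closure (Set.range t')) := h1.1
  have hfin : Finite ((Subgroup.closure (Set.range t')).map (Subgroup.center Q).subtype) := by
    exact Finite.of_surjective _ (Subgroup.subtype _ |>.subgroupMap_surjective _ : Function.Surjective ((Subgroup.center Q).subtype.subgroupMap (Subgroup.closure (Set.range t'))))
  refine (Nat.card_mono (Set.toFinite _) hle).trans ?_
  refine le_trans ?_ h1.2
  exact Nat.card_le_card_of_surjective _ ((Subgroup.center Q).subtype.subgroupMap_surjective (Subgroup.closure (Set.range t')))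

lemma comm_mul_right {Q : Type*} [Group Q] (y a b : Q) (h : ⁅y, b⁆ ∈ Subgroup.center Q) :
    ⁅y, a * b⁆ = ⁅y, a⁆ * ⁅y, b⁆ := by
  have h1 : ⁅y, a * b⁆ = ⁅y, a⁆ * (a * ⁅y, b⁆ * a⁻¹) := by
    simp only [commutatorElement_def]; group
  rw [h1, Subgroup.mem_center_iff.1 h a]; group

lemma comm_mul_left {Q : Type*} [Group Q] (x a b : Q) (h : ⁅b, x⁆ ∈ Subgroup.center Q) :
    ⁅a * b, x⁆ = ⁅a, x⁆ * ⁅b, x⁆ := by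
  have h1 : ⁅a * b, x⁆ = (a * ⁅b, x⁆ * a⁻¹) * ⁅a, x⁆ := by
    simp only [commutatorElement_def]; group
  rw [h1, Subgroup.mem_center_iff.1 h a]
  rw [mul_inv_cancel_right, Subgroup.mem_center_iff.1 h]

lemma comm_central_right {Q : Type*} [Group Q] (a : Q) {c : Q} (h : c ∈ Subgroup.center Q) :
    ⁅a, c⁆ = 1 := commutatorElement_eq_one_iff_mul_comm.2 (Subgroup.mem_center_iff.1 h a)

lemma comm_central_left {Q : Type*} [Group Q] (a : Q) {c : Q} (h : c ∈ Subgroup.center Q) :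
    ⁅c, a⁆ = 1 := commutatorElement_eq_one_iff_mul_comm.2 (Subgroup.mem_center_iff.1 h a).symm

/-- `x ↦ ⁅y, x⁆` as a homomorphism. -/
def phi {Q : Type*} [Group Q] (y : Q) (h : ∀ x, ⁅y, x⁆ ∈ Subgroup.center Q) : Q →* Q where
  toFun x := ⁅y, x⁆
  map_one' := by simp
  map_mul' a b := comm_mul_right y a b (h b)

/-- `m ↦ ⁅m, x⁆` as a homomorphism on a subgroup. -/
def psi {Q : Type*} [Group Q] (M : Subgroup Q) (x : Q)
    (h : ∀ m ∈ M, ⁅m, x⁆ ∈ Subgroup.center Q) : M →* Q where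
  toFun m := ⁅(m : Q), x⁆
  map_one' := by simp
  map_mul' a b := comm_mul_left x a b (h b b.2)

lemma comm_pow {Q : Type*} [Group Q] (M : Subgroup Q) (x : Q)
    (h : ∀ m ∈ M, ⁅m, x⁆ ∈ Subgroup.center Q) (y : Q) (hy : y ∈ M) (n : ℕ) :
    ⁅y ^ n, x⁆ = ⁅y, x⁆ ^ n := (psi M x h).map_pow ⟨y, hy⟩ n

lemma comm_zpow {Q : Type*} [Group Q] (M : Subgroup Q) (x : Q)
    (h : ∀ m ∈ M, ⁅m, x⁆ ∈ Subgroup.center Q) (y : Q) (hy : y ∈ M) (n : ℤ) :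
    ⁅y ^ n, x⁆ = ⁅y, x⁆ ^ n := (psi M x h).map_zpow ⟨y, hy⟩ n

/-- General step. -/
lemma step {Q ι : Type*} [Group Q] [Fintype ι] {p : ℕ} (hp : 0 < p) (M : Subgroup Q)
    (hM : ∀ m ∈ M, ∀ x, ⁅m, x⁆ ∈ Subgroup.center Q) (y : Q) (hy : y ∈ M)
    (hyp : y ^ p ∈ Subgroup.center Q)
    (hgen : ∀ m ∈ M, ∃ z : ℤ, ∃ c ∈ Subgroup.center Q, m = y ^ z * c)
    (t : ι → Q) (ht : ∀ x, ⁅y, x⁆ ∈ Subgroup.closure (Set.range fun i => ⁅y, t i⁆)) :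
    Nat.card (⁅M, (⊤ : Subgroup Q)⁆ : Subgroup Q) ≤ p ^ Fintype.card ι := by
  have := card_le_of_closure_center (fun i => ⁅y, t i⁆) (fun _ => p) (fun i => hM y hy _)
    (fun _ => hp) (fun i => by
      rw [← comm_pow M (t i) (fun m hm => hM m hm _) y hy]
      exact comm_central_left _ hyp) ⁅M, (⊤ : Subgroup Q)⁆ (by
      rw [Subgroup.commutator_le]
      intro m hm x _
      obtain ⟨z, c, hc, rfl⟩ := hgen m hm
      rw [comm_mul_left x _ _ (by rw [comm_central_left x hc]; exact one_mem _),
        comm_central_left x hc, mul_one, comm_zpow M x (fun m hm => hM m hm _) y hy]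
      exact Subgroup.zpow_mem _ (ht x) z)
  simpa using this

lemma gen_d {Q ι : Type*} [Group Q] (y : Q) (h : ∀ x, ⁅y, x⁆ ∈ Subgroup.center Q)
    (t : ι → Q) (ht : Subgroup.closure (Set.range t) ⊔ Subgroup.center Q = ⊤) (x : Q) :
    ⁅y, x⁆ ∈ Subgroup.closure (Set.range fun i => ⁅y, t i⁆) := by
  have : (⊤ : Subgroup Q) ≤
      (Subgroup.closure (Set.range fun i => ⁅y, t i⁆)).comap (phi y h) := by
    rw [← ht, sup_le_iff, Subgroup.closure_le]
    constructor
    · rintro _ ⟨i, rfl⟩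
      exact Subgroup.subset_closure ⟨i, rfl⟩
    · intro c hc
      rw [Subgroup.mem_comap]
      change ⁅y, c⁆ ∈ Subgroup.closure (Set.range fun i => ⁅y, t i⁆)
      rw [comm_central_right y hc]; exact one_mem _
  exact this (Subgroup.mem_top x)

lemma jac {Q : Type*} [Group Q] (a b c u v : Q) (hu : c * a * c⁻¹ = u * a)
    (hv : c * b * c⁻¹ = v * b) (hua : Commute u a) (hub : Commute u b) (hva : Commute v a)
    (hvb : Commute v b) (huv : Commute u v) : ⁅a, b⁆ * c = c * ⁅a, b⁆ := by
  have h1 : c * ⁅a, b⁆ * c⁻¹ = ⁅u * a, v * b⁆ := by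
    rw [← hu, ← hv]; simp only [commutatorElement_def]; group
  have h2 : ⁅u * a, v * b⁆ = ⁅a, b⁆ := by
    have e1 : ⁅u, v * b⁆ = 1 :=
      commutatorElement_eq_one_iff_mul_comm.2 (huv.mul_right hub)
    have e2 : ⁅a, v⁆ = 1 := commutatorElement_eq_one_iff_mul_comm.2 hva.symm
    have e3 : ⁅u * a, v * b⁆ = u * ⁅a, v * b⁆ * u⁻¹ * ⁅u, v * b⁆ := by
      simp only [commutatorElement_def]; group
    have e4 : ⁅a, v * b⁆ = ⁅a, v⁆ * (v * ⁅a, b⁆ * v⁻¹) := by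
      simp only [commutatorElement_def]; group
    have cu : Commute u ⁅a, b⁆ := by
      rw [commutatorElement_def]
      exact ((hua.mul_right hub).mul_right hua.inv_right).mul_right hub.inv_right
    have cv : Commute v ⁅a, b⁆ := by
      rw [commutatorElement_def]
      exact ((hva.mul_right hvb).mul_right hva.inv_right).mul_right hvb.inv_right
    rw [e3, e1, e4, e2, one_mul, cv.eq, mul_inv_cancel_right, cu.eq, mul_inv_cancel_right, mul_one]
  rw [h2] at h1
  exact (mul_inv_eq_iff_eq_mul.1 h1).symm

/-- Generation by two elements at the top. -/
lemma gen_two {Q : Type*} [Group Q] (M : Subgroup Q)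
    (hM : ∀ m ∈ M, ∀ x, ⁅m, x⁆ ∈ Subgroup.center Q) (hcM : commutator Q ≤ M) (a b : Q)
    (hgen : ∀ m ∈ M, ∃ z : ℤ, ∃ c ∈ Subgroup.center Q, m = ⁅a, b⁆ ^ z * c) (x : Q) :
    ⁅⁅a, b⁆, x⁆ ∈ Subgroup.closure (Set.range fun i : Fin 2 => ⁅⁅a, b⁆, ![a, b] i⁆) := by
  set K := Subgroup.closure (Set.range fun i : Fin 2 => ⁅⁅a, b⁆, ![a, b] i⁆) with hK
  have hcomm : ∀ u v : Q, ⁅u, v⁆ ∈ M := fun u v =>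
    hcM (Subgroup.commutator_mem_commutator (Subgroup.mem_top u) (Subgroup.mem_top v))
  have hKc : K ≤ Subgroup.center Q := by
    rw [hK, Subgroup.closure_le]
    rintro _ ⟨i, rfl⟩
    exact hM _ (hcomm a b) _
  have hKn : K.Normal := ⟨fun n hn g => by
    rw [Subgroup.mem_center_iff.1 (hKc hn) g, mul_inv_cancel_right]; exact hn⟩
  let f := QuotientGroup.mk' K
  have hfa : Commute (f ⁅a, b⁆) (f a) := by
    rw [← commutatorElement_eq_one_iff_commute, ← map_commutatorElement]
    exact (QuotientGroup.eq_one_iff _).2 (Subgroup.subset_closure ⟨0, rfl⟩)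
  have hfb : Commute (f ⁅a, b⁆) (f b) := by
    rw [← commutatorElement_eq_one_iff_commute, ← map_commutatorElement]
    exact (QuotientGroup.eq_one_iff _).2 (Subgroup.subset_closure ⟨1, rfl⟩)
  have hcen : ∀ c ∈ Subgroup.center Q, ∀ g, Commute (f c) (f g) := by
    intro c hc g
    have h : f (c * g) = f (g * c) := by rw [Subgroup.mem_center_iff.1 hc g]
    simpa [Commute, SemiconjBy] using h
  obtain ⟨s, c, hc, hu⟩ := hgen _ (hcomm x a)
  obtain ⟨r, c', hc', hv⟩ := hgen _ (hcomm x b)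
  have hfu : f ⁅x, a⁆ = f ⁅a, b⁆ ^ s * f c := by rw [hu]; simp
  have hfv : f ⁅x, b⁆ = f ⁅a, b⁆ ^ r * f c' := by rw [hv]; simp
  have := jac (f a) (f b) (f x) (f ⁅x, a⁆) (f ⁅x, b⁆)
    (by simp only [← map_mul, ← map_inv, commutatorElement_def]; congr 1; group)
    (by simp only [← map_mul, ← map_inv, commutatorElement_def]; congr 1; group)
    (by rw [hfu]; exact (hfa.zpow_left s).mul_left (hcen c hc a))
    (by rw [hfu]; exact (hfb.zpow_left s).mul_left (hcen c hc b))
    (by rw [hfv]; exact (hfa.zpow_left r).mul_left (hcen c' hc' a))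
    (by rw [hfv]; exact (hfb.zpow_left r).mul_left (hcen c' hc' b))
    (by
      rw [hfu]
      refine Commute.mul_left ?_ (hcen c hc _)
      rw [hfv]
      refine Commute.mul_right ?_ ?_
      · exact ((Commute.refl (f ⁅a, b⁆)).zpow_left s).zpow_right r
      · rw [← map_zpow]; exact (hcen c' hc' _).symm)
  rw [← QuotientGroup.eq_one_iff]
  change f _ = 1
  rw [map_commutatorElement, commutatorElement_eq_one_iff_mul_comm, map_commutatorElement]
  exact this

/-- class two bound -/
lemma class_two {Q ι : Type*} [Group Q] [Fintype ι] [LinearOrder ι]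
    (hQ : commutator Q ≤ Subgroup.center Q) (x : ι → Q) (m : ι → ι → ℕ) (hm : ∀ i j, 0 < m i j)
    (hx : Subgroup.closure (Set.range x) ⊔ Subgroup.center Q = ⊤)
    (hpow : ∀ i j, ⁅x i, x j⁆ ^ m i j = 1) :
    Nat.card (commutator Q) ≤ ∏ q : {q : ι × ι // q.1 < q.2}, m q.1.1 q.1.2 := by
  have hcomm : ∀ u v : Q, ⁅u, v⁆ ∈ Subgroup.center Q := fun u v =>
    hQ (Subgroup.commutator_mem_commutator (Subgroup.mem_top u) (Subgroup.mem_top v))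
  let t : {q : ι × ι // q.1 < q.2} → Q := fun q => ⁅x q.1.1, x q.1.2⁆
  have hbase : ∀ i j, ⁅x i, x j⁆ ∈ Subgroup.closure (Set.range t) := by
    intro i j
    rcases lt_trichotomy i j with h | h | h
    · exact Subgroup.subset_closure ⟨⟨(i, j), h⟩, rfl⟩
    · subst h; simp
    · rw [← commutatorElement_inv]
      exact inv_mem (Subgroup.subset_closure ⟨⟨(j, i), h⟩, rfl⟩)
  have h1 : ∀ i g, ⁅x i, g⁆ ∈ Subgroup.closure (Set.range t) := by
    intro i g
    have := gen_d (x i) (hcomm _) x hx g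
    refine (Subgroup.closure_le _).2 ?_ this
    rintro _ ⟨j, rfl⟩
    exact hbase i j
  refine card_le_of_closure_center t (fun q => m q.1.1 q.1.2) (fun q => hcomm _ _)
    (fun q => hm _ _) (fun q => hpow _ _) _ ?_
  rw [commutator_def, Subgroup.commutator_le]
  intro g _ h _
  have := gen_d h (hcomm _) x hx g
  rw [← commutatorElement_inv]
  refine inv_mem ((Subgroup.closure_le _).2 ?_ this)
  rintro _ ⟨j, rfl⟩
  change ⁅h, x j⁆ ∈ Subgroup.closure (Set.range t)
  rw [← commutatorElement_inv]
  exact inv_mem (h1 j h)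

lemma rel_card {E : Type*} [Group E] (M N : Subgroup E) [M.Normal] [N.Normal] (h : N ≤ M) :
    Nat.card (⁅M, (⊤ : Subgroup E)⁆ : Subgroup E) =
      Nat.card (⁅N, (⊤ : Subgroup E)⁆ : Subgroup E) *
      Nat.card (⁅M.map (QuotientGroup.mk' ⁅N, (⊤ : Subgroup E)⁆), (⊤ : Subgroup (E ⧸ ⁅N, (⊤ : Subgroup E)⁆))⁆ :
        Subgroup (E ⧸ ⁅N, (⊤ : Subgroup E)⁆)) := by
  have hle : ⁅N, (⊤ : Subgroup E)⁆ ≤ ⁅M, (⊤ : Subgroup E)⁆ := Subgroup.commutator_mono h le_rfl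
  have h1 : ⁅M.map (QuotientGroup.mk' ⁅N, (⊤ : Subgroup E)⁆), (⊤ : Subgroup (E ⧸ ⁅N, (⊤ : Subgroup E)⁆))⁆
      = ⁅M, (⊤ : Subgroup E)⁆.map (QuotientGroup.mk' ⁅N, (⊤ : Subgroup E)⁆) := by
    rw [Subgroup.map_commutator, Subgroup.map_top_of_surjective _ (QuotientGroup.mk'_surjective _)]
  rw [h1, ← Subgroup.relIndex_ker, QuotientGroup.ker_mk']
  rw [← Subgroup.relIndex_bot_left, ← Subgroup.relIndex_bot_left,
    Subgroup.relIndex_mul_relIndex _ _ _ bot_le hle]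

lemma stepE {E : Type*} [Group E] {p : ℕ} (hp : 0 < p) (M N : Subgroup E) [M.Normal] [N.Normal]
    (h : N ≤ M) (hMN : ⁅M, (⊤ : Subgroup E)⁆ ≤ N) (y : E) (hy : y ∈ M) (hyp : y ^ p ∈ N)
    (hgen : ∀ m ∈ M, ∃ z : ℤ, (y ^ z)⁻¹ * m ∈ N) :
    (∀ {d : ℕ} (t : Fin d → E), Subgroup.closure (Set.range t) ⊔ N = ⊤ →
      Nat.card (⁅M, (⊤ : Subgroup E)⁆ : Subgroup E) ≤
        Nat.card (⁅N, (⊤ : Subgroup E)⁆ : Subgroup E) * p ^ d) ∧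
    (∀ a b : E, y = ⁅a, b⁆ → commutator E ≤ M →
      Nat.card (⁅M, (⊤ : Subgroup E)⁆ : Subgroup E) ≤
        Nat.card (⁅N, (⊤ : Subgroup E)⁆ : Subgroup E) * p ^ 2) := by
  set f := QuotientGroup.mk' ⁅N, (⊤ : Subgroup E)⁆ with hf
  have hfs : Function.Surjective f := QuotientGroup.mk'_surjective _
  have hcen : ∀ n ∈ N, f n ∈ Subgroup.center (E ⧸ ⁅N, (⊤ : Subgroup E)⁆) := by
    intro n hn
    rw [Subgroup.mem_center_iff]
    intro g
    obtain ⟨g, rfl⟩ := hfs g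
    symm
    rw [← commutatorElement_eq_one_iff_mul_comm, ← map_commutatorElement]
    exact (QuotientGroup.eq_one_iff _).2
      (Subgroup.commutator_mem_commutator hn (Subgroup.mem_top g))
  have hM' : ∀ m ∈ M.map f, ∀ x, ⁅m, x⁆ ∈ Subgroup.center (E ⧸ ⁅N, (⊤ : Subgroup E)⁆) := by
    rintro _ ⟨m, hm, rfl⟩ x
    obtain ⟨x, rfl⟩ := hfs x
    rw [← map_commutatorElement]
    exact hcen _ (hMN (Subgroup.commutator_mem_commutator hm (Subgroup.mem_top x)))
  have hgen' : ∀ m ∈ M.map f, ∃ z : ℤ, ∃ c ∈ Subgroup.center (E ⧸ ⁅N, (⊤ : Subgroup E)⁆),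
      m = f y ^ z * c := by
    rintro _ ⟨m, hm, rfl⟩
    obtain ⟨z, hz⟩ := hgen m hm
    exact ⟨z, _, hcen _ hz, by simp⟩
  have hy' : f y ∈ M.map f := Subgroup.mem_map_of_mem f hy
  have hyp' : f y ^ p ∈ Subgroup.center (E ⧸ ⁅N, (⊤ : Subgroup E)⁆) := by
    rw [← map_pow]; exact hcen _ hyp
  have hst := fun (d : ℕ) (t : Fin d → (E ⧸ ⁅N, (⊤ : Subgroup E)⁆)) =>
    step hp (M.map f) hM' (f y) hy' hyp' hgen' t
  constructor
  · intro d t ht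
    rw [rel_card M N h]
    refine Nat.mul_le_mul_left _ ?_
    have := hst d (fun i => f (t i)) (gen_d (f y) (hM' _ hy') _ ?_)
    · simpa using this
    · rw [eq_top_iff, ← Subgroup.map_top_of_surjective f hfs]
      refine (Subgroup.map_mono ht.ge).trans ?_
      rw [Subgroup.map_sup]
      refine sup_le_sup ?_ ?_
      · rw [MonoidHom.map_closure, ← Set.range_comp]; rfl
      · rintro _ ⟨n, hn, rfl⟩; exact hcen n hn
  · rintro a b rfl hc
    rw [rel_card M N h]
    refine Nat.mul_le_mul_left _ ?_
    rw [map_commutatorElement] at *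
    have := hst 2 ![f a, f b] (gen_two (M.map f) hM' ?_ (f a) (f b) hgen')
    · simpa using this
    · rw [commutator_def, ← Subgroup.map_top_of_surjective f hfs, ← Subgroup.map_commutator]
      exact Subgroup.map_mono hc

lemma comm_lt {G : Type*} [Group G] [Group.IsNilpotent G] (N : Subgroup G) [N.Normal]
    (hN : N ≤ ⁅N, (⊤ : Subgroup G)⁆) : N = ⊥ := by
  have : ∀ n, N ≤ Subgroup.lowerCentralSeries (⊤ : Subgroup G) n := by
    intro n
    induction n with
    | zero => simp
    | succ n ih =>
      exact hN.trans (Subgroup.commutator_mono ih le_rfl)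
  obtain ⟨n, hn⟩ := Subgroup.nilpotent_iff_lowerCentralSeries.1 ‹Group.IsNilpotent G›
  exact le_bot_iff.1 (hn ▸ this n)

lemma exists_max {G : Type*} [Group G] [Finite G] {p n : ℕ} (hp : p.Prime)
    (hG : Nat.card G = p ^ n) (N : Subgroup G) [N.Normal] {j : ℕ} (hN : Nat.card N = p ^ (j + 1)) :
    ∃ N1 : Subgroup G, N1.Normal ∧ N1 ≤ N ∧ Nat.card N1 = p ^ j ∧ ⁅N, (⊤ : Subgroup G)⁆ ≤ N1 ∧
      ∀ y ∈ N, y ∉ N1 → y ^ p ∈ N1 ∧ ∀ m ∈ N, ∃ z : ℤ, (y ^ z)⁻¹ * m ∈ N1 := by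
  have : Fact p.Prime := ⟨hp⟩
  have hpg : IsPGroup p G := IsPGroup.of_card hG
  have : Group.IsNilpotent G := hpg.isNilpotent
  have hcle : ⁅N, (⊤ : Subgroup G)⁆ ≤ N := Subgroup.commutator_le_left N ⊤
  obtain ⟨i, hi⟩ := (IsPGroup.iff_card (p := p)).1 (hpg.to_subgroup ⁅N, (⊤ : Subgroup G)⁆)
  have hij : i ≤ j := by
    by_contra hcon
    have h1 : Nat.card (⁅N, (⊤ : Subgroup G)⁆ : Subgroup G) ≥ Nat.card N := by
      rw [hi, hN]; exact Nat.pow_le_pow_right hp.pos (by omega)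
    have h2 := Subgroup.eq_of_le_of_card_ge hcle h1
    have h3 := comm_lt N h2.ge
    rw [h3, Subgroup.card_bot] at hN
    exact (Nat.one_lt_pow (Nat.succ_ne_zero j) hp.one_lt).ne hN
  have hcs : Nat.card ((⁅N, (⊤ : Subgroup G)⁆).subgroupOf N) = p ^ i := by
    rw [← hi]; exact Nat.card_congr (Subgroup.subgroupOfEquivOfLe hcle).toEquiv
  obtain ⟨K, hK, hKle⟩ := Sylow.exists_subgroup_card_pow_prime_le p
    (show p ^ j ∣ Nat.card N by rw [hN]; exact pow_dvd_pow p (Nat.le_succ j)) _ hcs hij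
  have hKN : K.map N.subtype ≤ N := by
    rintro _ ⟨x, _, rfl⟩; exact x.2
  have hle : ⁅N, (⊤ : Subgroup G)⁆ ≤ K.map N.subtype := by
    intro x hx
    exact ⟨⟨x, hcle hx⟩, hKle hx, rfl⟩
  have hcard : Nat.card (K.map N.subtype) = p ^ j := by
    rw [← hK]
    exact (Nat.card_congr (K.equivMapOfInjective _ N.subtype_injective).toEquiv).symm
  have hnorm : (K.map N.subtype).Normal := by
    refine ⟨fun x hx g => ?_⟩
    have h1 : g * x * g⁻¹ = ⁅x, g⁆⁻¹ * x := by
      simp only [commutatorElement_def]; group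
    rw [h1]
    exact mul_mem (inv_mem (hle (Subgroup.commutator_mem_commutator (hKN hx)
      (Subgroup.mem_top g)))) hx
  refine ⟨K.map N.subtype, hnorm, hKN, hcard, hle, ?_⟩
  intro y hy hyn
  have hrel : (K.map N.subtype).relIndex N = p := by
    have h1 := Subgroup.relIndex_mul_relIndex ⊥ (K.map N.subtype) N bot_le hKN
    rw [Subgroup.relIndex_bot_left, Subgroup.relIndex_bot_left, hcard, hN, pow_succ] at h1
    exact Nat.eq_of_mul_eq_mul_left (pow_pos hp.pos j) h1
  constructor
  · have := Subgroup.pow_index_mem ((K.map N.subtype).subgroupOf N) ⟨y, hy⟩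
    rw [← Subgroup.relIndex, hrel] at this
    exact this
  · intro m hm
    set L := Subgroup.zpowers y ⊔ K.map N.subtype with hL
    have hLN : L ≤ N := sup_le (by simpa using hy) hKN
    have hdvd := Subgroup.relIndex_mul_relIndex (K.map N.subtype) L N le_sup_right hLN
    rw [hrel] at hdvd
    have hLeq : L.relIndex N = 1 := by
      rcases (Nat.Prime.eq_one_or_self_of_dvd hp _ ⟨_, hdvd.symm⟩) with h | h
      · exfalso
        rw [Subgroup.relIndex_eq_one] at h
        exact hyn (h (Subgroup.mem_sup_left (Subgroup.mem_zpowers y)))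
      · rw [h] at hdvd
        exact Nat.eq_of_mul_eq_mul_left hp.pos (by simpa using hdvd)
    have hmL : m ∈ L := Subgroup.relIndex_eq_one.1 hLeq hm
    rw [hL, Subgroup.mem_sup_of_normal_right] at hmL
    obtain ⟨a, ⟨z, rfl⟩, b, hb, rfl⟩ := hmL
    exact ⟨z, by simpa using hb⟩

lemma chain {E G : Type*} [Group E] [Group G] [Finite G] {p n d : ℕ} (hp : p.Prime)
    (hG : Nat.card G = p ^ n) (π : E →* G) (hπ : Function.Surjective π)
    (hker : π.ker ≤ Subgroup.center E) (t : Fin d → E)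
    (ht : Subgroup.closure (Set.range t) ⊔ π.ker = ⊤) (j : ℕ) :
    ∀ (N : Subgroup G), N.Normal → Nat.card N = p ^ j →
      Nat.card (⁅N.comap π, (⊤ : Subgroup E)⁆ : Subgroup E) ≤ p ^ (j * d) := by
  induction j with
  | zero =>
    intro N hN hc
    have h0 : N = ⊥ := Subgroup.eq_bot_of_card_eq _ (by simpa using hc)
    subst h0
    have : ⁅(⊥ : Subgroup G).comap π, (⊤ : Subgroup E)⁆ = ⊥ := by
      rw [eq_bot_iff, Subgroup.commutator_le]
      intro g hg h _
      rw [Subgroup.mem_bot]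
      exact comm_central_left _ (hker hg)
    rw [this]; simp
  | succ j ih =>
    intro N hN hc
    obtain ⟨N1, hN1, hle, hc1, hcomm, hy⟩ := exists_max hp hG N hc
    obtain ⟨y, hyN, hyN1⟩ : ∃ y ∈ N, y ∉ N1 := by
      by_contra! hcon
      have := le_antisymm hle hcon
      rw [this, hc] at hc1
      have := Nat.pow_right_injective hp.two_le hc1
      omega
    obtain ⟨hyp, hgen⟩ := hy y hyN hyN1
    obtain ⟨y, rfl⟩ := hπ y
    have hst := (stepE hp.pos (N.comap π) (N1.comap π) (Subgroup.comap_mono hle) (by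
      rw [Subgroup.commutator_le]
      intro g hg h _
      rw [Subgroup.mem_comap, map_commutatorElement]
      exact hcomm (Subgroup.commutator_mem_commutator hg (Subgroup.mem_top _))) y hyN
      (by simpa using hyp) (fun m hm => by
        obtain ⟨z, hz⟩ := hgen (π m) hm
        exact ⟨z, by simpa using hz⟩)).1 t (by
        rw [eq_top_iff, ← ht]
        exact sup_le_sup le_rfl (Subgroup.ker_le_comap π N1))
    refine hst.trans ?_
    rw [Nat.succ_mul, pow_add]
    exact Nat.mul_le_mul_right _ (ih N1 hN1 hc1)

lemma comap_comm {E G : Type*} [Group E] [Group G] (π : E →* G) (hπ : Function.Surjective π)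
    (hker : π.ker ≤ Subgroup.center E) (hcE : commutator E ≤ (commutator G).comap π) :
    ⁅(commutator G).comap π, (⊤ : Subgroup E)⁆ = ⁅commutator E, (⊤ : Subgroup E)⁆ := by
  refine le_antisymm ?_ (Subgroup.commutator_mono hcE le_rfl)
  rw [Subgroup.commutator_le]
  intro g hg h _
  have h1 : (commutator E).map π = commutator G := by
    rw [commutator_def E, Subgroup.map_commutator, Subgroup.map_top_of_surjective _ hπ]; rfl
  rw [← h1] at hg
  obtain ⟨g', hg', hgg⟩ := hg
  have h2 : g'⁻¹ * g ∈ Subgroup.center E := hker (by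
    rw [MonoidHom.mem_ker, map_mul, map_inv, hgg, inv_mul_cancel])
  have h3 : ⁅g, h⁆ = ⁅g', h⁆ := by
    have h4 := comm_central_left h h2
    have := comm_mul_left h g' (g'⁻¹ * g) (by rw [h4]; exact one_mem _)
    rw [h4, mul_one, mul_inv_cancel_left] at this
    exact this
  rw [h3]
  exact Subgroup.commutator_mem_commutator hg' (Subgroup.mem_top _)

lemma gamma3 {E G : Type*} [Group E] [Group G] [Finite G] {p n d k : ℕ} (hp : p.Prime)
    (hG : Nat.card G = p ^ n) (π : E →* G) (hπ : Function.Surjective π)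
    (hker : π.ker ≤ Subgroup.center E) (t : Fin d → E)
    (ht : Subgroup.closure (Set.range t) ⊔ π.ker = ⊤) (hk : Nat.card (commutator G) = p ^ (k + 1)) :
    Nat.card (⁅commutator E, (⊤ : Subgroup E)⁆ : Subgroup E) ≤ p ^ (k * d + 2) := by
  obtain ⟨N1, hN1, hle, hc1, hcomm, hy⟩ := exists_max hp hG (commutator G) hk
  obtain ⟨a, b, hab⟩ : ∃ a b : G, ⁅a, b⁆ ∉ N1 := by
    by_contra! hcon
    have : commutator G ≤ N1 := by
      rw [commutator_def, Subgroup.commutator_le]; intro a _ b _; exact hcon a b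
    have := le_antisymm hle this
    rw [this, hk] at hc1
    have := Nat.pow_right_injective hp.two_le hc1
    omega
  have hcm : ∀ a b : G, ⁅a, b⁆ ∈ commutator G := fun a b =>
    Subgroup.commutator_mem_commutator (Subgroup.mem_top a) (Subgroup.mem_top b)
  obtain ⟨hyp, hgen⟩ := hy _ (hcm a b) hab
  obtain ⟨a, rfl⟩ := hπ a
  obtain ⟨b, rfl⟩ := hπ b
  rw [← map_commutatorElement] at hyp hgen
  have hcE : commutator E ≤ (commutator G).comap π := by
    rw [commutator_def E, Subgroup.commutator_le]
    intro a _ b _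
    rw [Subgroup.mem_comap, map_commutatorElement]; exact hcm _ _
  have hst := (stepE hp.pos ((commutator G).comap π) (N1.comap π) (Subgroup.comap_mono hle) (by
      rw [Subgroup.commutator_le]
      intro g hg h _
      rw [Subgroup.mem_comap, map_commutatorElement]
      exact hcomm (Subgroup.commutator_mem_commutator hg (Subgroup.mem_top _))) ⁅a, b⁆
      (by rw [Subgroup.mem_comap, map_commutatorElement]; exact hcm _ _)
      (by simpa using hyp) (fun m hm => by
        obtain ⟨z, hz⟩ := hgen (π m) hm
        exact ⟨z, by simpa using hz⟩)).2 a b rfl hcE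
  have heq := comap_comm π hπ hker hcE
  rw [← heq]
  refine hst.trans ?_
  rw [pow_add]
  exact Nat.mul_le_mul_right _ (chain hp hG π hπ hker t ht k N1 hN1 hc1)

lemma hopf_mul {F G : Type*} [Group F] [Group G] (π : F →* G) (hπ : Function.Surjective π) :
    hopfCard π * Nat.card (commutator G) =
      Nat.card (commutator (F ⧸ ⁅π.ker, (⊤ : Subgroup F)⁆)) := by
  have h1 : hopfCard π = ⁅π.ker, (⊤ : Subgroup F)⁆.relIndex (π.ker ⊓ commutator F) := rfl
  have h2 : (commutator F).map π = commutator G := by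
    rw [commutator_def F, Subgroup.map_commutator, Subgroup.map_top_of_surjective _ hπ]; rfl
  have h3 : (commutator F).map (QuotientGroup.mk' ⁅π.ker, (⊤ : Subgroup F)⁆) =
      commutator (F ⧸ ⁅π.ker, (⊤ : Subgroup F)⁆) := by
    rw [commutator_def F, Subgroup.map_commutator,
      Subgroup.map_top_of_surjective _ (QuotientGroup.mk'_surjective _)]; rfl
  rw [h1, ← h2, ← h3, ← Subgroup.relIndex_ker, ← Subgroup.relIndex_ker, QuotientGroup.ker_mk',
    ← Subgroup.inf_relIndex_right π.ker (commutator F)]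
  refine Subgroup.relIndex_mul_relIndex _ _ _ (le_inf (Subgroup.commutator_le_left _ _) ?_)
    inf_le_right
  exact Subgroup.commutator_mono le_top le_rfl

lemma gamma_mul {E : Type*} [Group E] :
    Nat.card (commutator E) = Nat.card (⁅commutator E, (⊤ : Subgroup E)⁆ : Subgroup E) *
      Nat.card (commutator (E ⧸ ⁅commutator E, (⊤ : Subgroup E)⁆)) := by
  have h3 : (commutator E).map (QuotientGroup.mk' ⁅commutator E, (⊤ : Subgroup E)⁆) =
      commutator (E ⧸ ⁅commutator E, (⊤ : Subgroup E)⁆) := by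
    rw [commutator_def (E ⧸ ⁅commutator E, (⊤ : Subgroup E)⁆),
      ← Subgroup.map_top_of_surjective _ (QuotientGroup.mk'_surjective ⁅commutator E, (⊤ : Subgroup E)⁆),
      ← Subgroup.map_commutator]
    rfl
  rw [← h3, ← Subgroup.relIndex_ker, QuotientGroup.ker_mk', ← Subgroup.relIndex_bot_left,
    ← Subgroup.relIndex_bot_left, Subgroup.relIndex_mul_relIndex _ _ _ bot_le
      (Subgroup.commutator_le_left _ _)]

lemma class_two_E {E B ι : Type*} [Group E] [Group B] [Fintype ι] [LinearOrder ι] {p : ℕ}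
    (hp : 0 < p) (α : E →* B) (hα : Function.Surjective α)
    (hker : ∀ g ∈ α.ker, ∀ h, ⁅g, h⁆ ∈ ⁅commutator E, (⊤ : Subgroup E)⁆)
    (b : ι → B) (e : ι → ℕ) (hb : Subgroup.closure (Set.range b) = ⊤)
    (hbe : ∀ i, b i ^ p ^ e i = 1) :
    Nat.card (commutator (E ⧸ ⁅commutator E, (⊤ : Subgroup E)⁆)) ≤
      p ^ (∑ q : {q : ι × ι // q.1 < q.2}, min (e q.1.1) (e q.1.2)) := by
  set f := QuotientGroup.mk' ⁅commutator E, (⊤ : Subgroup E)⁆ with hf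
  have hfs : Function.Surjective f := QuotientGroup.mk'_surjective _
  choose x hx using fun i => hα (b i)
  have hcen : ∀ n : E, (∀ h, ⁅n, h⁆ ∈ ⁅commutator E, (⊤ : Subgroup E)⁆) →
      f n ∈ Subgroup.center (E ⧸ ⁅commutator E, (⊤ : Subgroup E)⁆) := by
    intro n hn
    rw [Subgroup.mem_center_iff]
    intro g
    obtain ⟨g, rfl⟩ := hfs g
    symm
    rw [← commutatorElement_eq_one_iff_mul_comm, ← map_commutatorElement]
    exact (QuotientGroup.eq_one_iff _).2 (hn g)
  have hQ : commutator (E ⧸ ⁅commutator E, (⊤ : Subgroup E)⁆) ≤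
      Subgroup.center (E ⧸ ⁅commutator E, (⊤ : Subgroup E)⁆) := by
    rw [commutator_def (E ⧸ ⁅commutator E, (⊤ : Subgroup E)⁆), Subgroup.commutator_le]
    intro u _ v _
    obtain ⟨u, rfl⟩ := hfs u
    obtain ⟨v, rfl⟩ := hfs v
    rw [← map_commutatorElement]
    refine hcen _ fun h => ?_
    exact Subgroup.commutator_mem_commutator
      (Subgroup.commutator_mem_commutator (Subgroup.mem_top u) (Subgroup.mem_top v))
      (Subgroup.mem_top _)
  have hcomm : ∀ u v : (E ⧸ ⁅commutator E, (⊤ : Subgroup E)⁆),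
      ⁅u, v⁆ ∈ Subgroup.center (E ⧸ ⁅commutator E, (⊤ : Subgroup E)⁆) := fun u v =>
    hQ (Subgroup.commutator_mem_commutator (Subgroup.mem_top u) (Subgroup.mem_top v))
  have hxe : ∀ i, f (x i) ^ p ^ e i ∈
      Subgroup.center (E ⧸ ⁅commutator E, (⊤ : Subgroup E)⁆) := by
    intro i
    rw [← map_pow]
    refine hcen _ (hker _ ?_)
    rw [MonoidHom.mem_ker, map_pow, hx, hbe]
  have := class_two hQ (fun i => f (x i)) (fun i j => p ^ min (e i) (e j))
    (fun i j => pow_pos hp _) ?_ ?_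
  · simpa [Finset.prod_pow_eq_pow_sum] using this
  · rw [eq_top_iff]
    rintro q -
    obtain ⟨g, rfl⟩ := hfs q
    have h1 : α g ∈ (Subgroup.closure (Set.range x)).map α := by
      rw [MonoidHom.map_closure, ← Set.range_comp]
      have : α ∘ x = b := funext hx
      rw [this, hb]; trivial
    obtain ⟨c, hc, hcg⟩ := h1
    have h2 : g = c * (c⁻¹ * g) := by group
    rw [h2, map_mul]
    refine Subgroup.mul_mem_sup ?_ (hcen _ (hker _ ?_))
    · have := Subgroup.mem_map_of_mem f hc
      rw [MonoidHom.map_closure, ← Set.range_comp] at this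
      exact this
    · rw [MonoidHom.mem_ker, map_mul, map_inv, hcg, inv_mul_cancel]
  · intro i j
    rcases le_total (e i) (e j) with h | h
    · rw [min_eq_left h, ← comm_pow ⊤ _ (fun m _ => hcomm m _) _ (Subgroup.mem_top _)]
      exact comm_central_left _ (hxe i)
    · rw [min_eq_right h]
      have := (phi (f (x i)) (hcomm _)).map_pow (f (x j)) (p ^ e j)
      change ⁅f (x i), f (x j) ^ p ^ e j⁆ = ⁅f (x i), f (x j)⁆ ^ p ^ e j at this
      rw [← this]
      exact comm_central_right _ (hxe j)

lemma pairs_sum {ι : Type*} [Fintype ι] [LinearOrder ι] (e : ι → ℕ) :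
    2 * (∑ q : {q : ι × ι // q.1 < q.2}, min (e q.1.1) (e q.1.2)) + ∑ i, e i =
      ∑ i, ∑ j, min (e i) (e j) := by
  classical
  have h1 : ∑ q : {q : ι × ι // q.1 < q.2}, min (e q.1.1) (e q.1.2) =
      ∑ i, ∑ j, if i < j then min (e i) (e j) else 0 := by
    rw [← Fintype.sum_prod_type' (f := fun i j => if i < j then min (e i) (e j) else 0),
      ← Finset.sum_filter]
    exact (Finset.sum_subtype (Finset.univ.filter fun q : ι × ι => q.1 < q.2) (by simp)
      (fun q : ι × ι => min (e q.1) (e q.2))).symm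
  have h2 : ∑ i, ∑ j, (if i < j then min (e i) (e j) else 0) =
      ∑ i, ∑ j, if j < i then min (e i) (e j) else 0 := by
    rw [Finset.sum_comm]
    simp_rw [min_comm]
  have h3 : ∑ i, e i = ∑ i, ∑ j, if i = j then min (e i) (e j) else 0 := by simp
  rw [two_mul, h1]
  nth_rewrite 2 [h2]
  rw [h3, ← Finset.sum_add_distrib, ← Finset.sum_add_distrib]
  refine Finset.sum_congr rfl fun i _ => ?_
  rw [← Finset.sum_add_distrib, ← Finset.sum_add_distrib]
  refine Finset.sum_congr rfl fun j _ => ?_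
  rcases lt_trichotomy i j with h | h | h
  · simp [h, h.not_gt, h.ne]
  · simp [h]
  · simp [h, h.not_gt, h.ne']

lemma min_sum_le {ι : Type*} [Fintype ι] (e : ι → ℕ) :
    ∑ i, ∑ j, min (e i) (e j) ≤ Fintype.card ι * ∑ i, e i ∧
    (∑ i, ∑ j, min (e i) (e j) = Fintype.card ι * ∑ i, e i → ∀ i j, e i = e j) := by
  have h1 : ∑ i, ∑ j, (e i + e j) = 2 * (Fintype.card ι * ∑ i, e i) := by
    simp only [Finset.sum_add_distrib, Finset.sum_const, Finset.card_univ, smul_eq_mul,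
      ← Finset.mul_sum]
    ring
  have h2 : ∀ i j, 2 * min (e i) (e j) ≤ e i + e j := fun i j => by omega
  have h3 : 2 * ∑ i, ∑ j, min (e i) (e j) ≤ ∑ i, ∑ j, (e i + e j) := by
    simp_rw [Finset.mul_sum]
    exact Finset.sum_le_sum fun i _ => Finset.sum_le_sum fun j _ => h2 i j
  refine ⟨by omega, fun h i j => ?_⟩
  rw [← h] at h1
  simp_rw [Finset.mul_sum] at h1
  have h4 := (Finset.sum_eq_sum_iff_of_le
    (fun i _ => Finset.sum_le_sum fun j _ => h2 i j)).1 h1.symm i (Finset.mem_univ _)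
  have h5 := (Finset.sum_eq_sum_iff_of_le (fun j _ => h2 i j)).1 h4 j (Finset.mem_univ _)
  omega

lemma exists_gens (G : Type*) [Group G] [Finite G] :
    ∃ s : Fin (minGens G) → G, Subgroup.closure (Set.range s) = ⊤ := by
  have hne : {n | ∃ S : Finset G, S.card = n ∧ Subgroup.closure (S : Set G) = ⊤}.Nonempty :=
    ⟨_, (Set.toFinite (Set.univ : Set G)).toFinset, rfl, by simp⟩
  obtain ⟨S, hS, hcl⟩ : ∃ S : Finset G, S.card = minGens G ∧ Subgroup.closure (S : Set G) = ⊤ :=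
    Nat.sInf_mem hne
  refine ⟨fun i => ((S.equivFinOfCardEq hS).symm i : G), ?_⟩
  rw [← hcl]
  congr 1
  ext g
  constructor
  · rintro ⟨i, rfl⟩; exact ((S.equivFinOfCardEq hS).symm i).2
  · intro hg; exact ⟨S.equivFinOfCardEq hS ⟨g, hg⟩, by simp⟩

lemma gens_pi {ι : Type*} [Fintype ι] [DecidableEq ι] (n : ι → ℕ) :
    Subgroup.closure (Set.range fun i =>
      (Pi.mulSingle i (Multiplicative.ofAdd 1) : ∀ i, Multiplicative (ZMod (n i)))) = ⊤ := by
  rw [eq_top_iff]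
  rintro b -
  rw [← Finset.univ_prod_mulSingle b]
  refine Subgroup.prod_mem _ fun i _ => ?_
  obtain ⟨z, hz⟩ := ZMod.intCast_surjective (Multiplicative.toAdd (b i))
  have : b i = (Multiplicative.ofAdd (1 : ZMod (n i))) ^ z := by
    rw [← ofAdd_zsmul, zsmul_one, hz]; rfl
  rw [this, Pi.mulSingle_zpow]
  exact Subgroup.zpow_mem _ (Subgroup.subset_closure (Set.mem_range_self i)) z

lemma rank_le {G ι : Type*} [Group G] [Fintype ι] {p d : ℕ} (hp : p.Prime) (n : ι → ℕ)
    (hn : ∀ i, p ∣ n i) (β : G →* ∀ i, Multiplicative (ZMod (n i)))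
    (hβ : Function.Surjective β) (s : Fin d → G) (hs : Subgroup.closure (Set.range s) = ⊤) :
    Fintype.card ι ≤ d := by
  classical
  have : NeZero p := ⟨hp.ne_zero⟩
  let γ : (∀ i, Multiplicative (ZMod (n i))) →* (ι → Multiplicative (ZMod p)) :=
    MonoidHom.pi fun i =>
      (AddMonoidHom.toMultiplicative (ZMod.castHom (hn i) (ZMod p)).toAddMonoidHom).comp
        (Pi.evalMonoidHom _ i)
  have hγ : Function.Surjective γ := by
    intro c
    choose b hb using fun i => ZMod.castHom_surjective (hn i) (Multiplicative.toAdd (c i))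
    exact ⟨fun i => Multiplicative.ofAdd (b i), funext fun i => hb i⟩
  have hsurj : Function.Surjective (γ.comp β) := hγ.comp hβ
  have h1 := (card_le_of_closure (fun i => γ.comp β (s i)) (fun _ => p) (fun _ => hp.pos)
    (fun i => by
      funext j
      apply Multiplicative.toAdd.injective
      simp) ⊤ (by
      have : Set.range (fun i => γ.comp β (s i)) = γ.comp β '' Set.range s :=
        Set.range_comp (γ.comp β) s
      rw [this, ← MonoidHom.map_closure, hs, Subgroup.map_top_of_surjective _ hsurj])).2
  simp only [Subgroup.card_top, Nat.card_pi, Finset.prod_const, Finset.card_univ,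
    Fintype.card_fin] at h1
  have h2 : Nat.card (Multiplicative (ZMod p)) = p := by simp
  rw [h2] at h1
  exact (Nat.pow_le_pow_iff_right hp.one_lt).1 h1

end SchurAux

open SchurAux

/-- If a non-abelian finite `p`-group `G` of order `p ^ n`, with commutator subgroup of
order `p ^ k` and `d = d(G)`, satisfies `|M(G)| = p ^ ((1/2)*(d-1)*(n+k-2)+1)`
(stated squared to avoid halves), then `G/G'` is homocyclic: it is isomorphic to a
direct product of `d` copies of `ZMod (p ^ e)` for some `e ≥ 1`. -/
theorem schur_bound_abelianization_homocyclic
    {p n k d : ℕ} (hp : p.Prime) (G : Type*) [Group G] [Finite G]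
    (hG : Nat.card G = p ^ n) (hna : ∃ a b : G, a * b ≠ b * a)
    (hk : Nat.card (commutator G) = p ^ k)
    (hd : d = minGens G)
    (hM : schurCard G ^ 2 = p ^ ((d - 1) * (n + k - 2) + 2)) :
    ∃ e : ℕ, 1 ≤ e ∧
      Nonempty (Abelianization G ≃* (Fin d → Multiplicative (ZMod (p ^ e)))) := by
  classical
  have : Fact p.Prime := ⟨hp⟩
  obtain ⟨a, b, hab⟩ := hna
  have hcne : commutator G ≠ ⊥ := by
    intro h
    have : ⁅a, b⁆ ∈ commutator G :=
      Subgroup.commutator_mem_commutator (Subgroup.mem_top a) (Subgroup.mem_top b)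
    rw [h, Subgroup.mem_bot, commutatorElement_eq_one_iff_mul_comm] at this
    exact hab this
  -- k is positive
  obtain ⟨k', rfl⟩ : ∃ k', k = k' + 1 := by
    refine Nat.exists_eq_succ_of_ne_zero ?_
    rintro rfl
    exact hcne (Subgroup.eq_bot_of_card_eq _ (by simpa using hk))
  -- generators
  obtain ⟨s, hs⟩ : ∃ s : Fin d → G, Subgroup.closure (Set.range s) = ⊤ := by
    rw [hd]; exact exists_gens G
  -- abelianization
  have hab_card : Nat.card (Abelianization G) * p ^ (k' + 1) = p ^ n := by
    rw [← hk, ← hG]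
    exact (Subgroup.card_eq_card_quotient_mul_card_subgroup (commutator G)).symm
  have hperf : Nat.card (Abelianization G) ≠ 1 := by
    intro h1
    rw [h1, one_mul, ← hk, ← hG] at hab_card
    have htop : commutator G = ⊤ := Subgroup.eq_top_of_card_eq _ hab_card
    have : Group.IsNilpotent G := (IsPGroup.of_card hG).isNilpotent
    refine hcne (comm_lt _ ?_)
    rw [htop, ← commutator_def, htop]
  have : Finite (Abelianization G) := Quotient.finite _
  obtain ⟨ι, _, m, hm1, ⟨φ⟩⟩ := CommGroup.equiv_prod_multiplicative_zmod_of_finite (Abelianization G)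
  have hm0 : ∀ i, NeZero (m i) := fun i => ⟨by have := hm1 i; omega⟩
  have hprod : Nat.card (Abelianization G) = ∏ i, m i := by
    rw [Nat.card_congr φ.toEquiv, Nat.card_pi]
    exact Finset.prod_congr rfl fun i _ => by simp
  have hpow : ∀ i, ∃ e, m i = p ^ e := by
    intro i
    have h1 : m i ∣ p ^ n := by
      rw [← hab_card, hprod]
      exact (Finset.dvd_prod_of_mem m (Finset.mem_univ i)).mul_right _
    obtain ⟨e, _, he⟩ := (Nat.dvd_prime_pow hp).1 h1
    exact ⟨e, he⟩
  choose e he using hpow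
  obtain rfl : m = fun i => p ^ e i := funext he
  clear he
  have he1 : ∀ i, 1 ≤ e i := by
    intro i
    have := hm1 i
    by_contra hcon
    have h0 : e i = 0 := by omega
    simp [h0] at this
  rw [Finset.prod_pow_eq_pow_sum] at hprod
  set N := ∑ i, e i with hN
  have hn : n = N + (k' + 1) := by
    rw [hprod, ← pow_add] at hab_card
    exact (Nat.pow_right_injective hp.two_le hab_card).symm
  have hNpos : 0 < N := by
    rcases Nat.eq_zero_or_pos N with h | h
    · rw [h, pow_zero] at hprod; exact absurd hprod hperf
    · exact h
  -- rank
  have hrank : Fintype.card ι ≤ d :=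
    rank_le hp (fun i => p ^ e i) (fun i => dvd_pow_self p (by have := he1 i; omega))
      (φ.toMonoidHom.comp Abelianization.of)
      (φ.surjective.comp (QuotientGroup.mk'_surjective _)) s hs
  have hrpos : 0 < Fintype.card ι := by
    rw [Fintype.card_pos_iff]
    by_contra hcon
    rw [not_nonempty_iff] at hcon
    simp at hN
    omega
  obtain ⟨d', rfl⟩ : ∃ d', d = d' + 1 := Nat.exists_eq_succ_of_ne_zero (by omega)
  -- the covering extension
  let F := FreeGroup G
  let π : F →* G := FreeGroup.lift (id : G → G)
  have hπ : Function.Surjective π := fun g => ⟨FreeGroup.of g, FreeGroup.lift_apply_of⟩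
  let B : Subgroup F := ⁅π.ker, (⊤ : Subgroup F)⁆
  let E := F ⧸ B
  have hBle : B ≤ π.ker := Subgroup.commutator_le_left _ _
  let ρ : E →* G := QuotientGroup.lift B π hBle
  have hρmk : ∀ x : F, ρ (QuotientGroup.mk' B x) = π x := fun x => rfl
  have hρ : Function.Surjective ρ := fun g => by
    obtain ⟨x, rfl⟩ := hπ g
    exact ⟨QuotientGroup.mk' B x, rfl⟩
  have hker : ρ.ker ≤ Subgroup.center E := by
    intro x hx
    obtain ⟨x, rfl⟩ := QuotientGroup.mk'_surjective B x
    rw [MonoidHom.mem_ker, hρmk] at hx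
    rw [Subgroup.mem_center_iff]
    intro g
    obtain ⟨g, rfl⟩ := QuotientGroup.mk'_surjective B g
    symm
    rw [← commutatorElement_eq_one_iff_mul_comm, ← map_commutatorElement]
    exact (QuotientGroup.eq_one_iff _).2
      (Subgroup.commutator_mem_commutator hx (Subgroup.mem_top g))
  choose t ht using fun i => hρ (s i)
  have htgen : Subgroup.closure (Set.range t) ⊔ ρ.ker = ⊤ := by
    rw [← Subgroup.comap_map_eq, MonoidHom.map_closure, ← Set.range_comp]
    have : ρ ∘ t = s := funext ht
    rw [this, hs, Subgroup.comap_top]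
  have hg3 := gamma3 hp hG ρ hρ hker t htgen hk
  have hcE : commutator E ≤ (commutator G).comap ρ := by
    rw [commutator_def E, Subgroup.commutator_le]
    intro a _ b _
    rw [Subgroup.mem_comap, map_commutatorElement]
    exact Subgroup.commutator_mem_commutator (Subgroup.mem_top _) (Subgroup.mem_top _)
  have hcc := comap_comm ρ hρ hker hcE
  let _ : LinearOrder ι := LinearOrder.lift' (Fintype.equivFin ι) (Fintype.equivFin ι).injective
  have hg2 := class_two_E (p := p) hp.pos ((φ.toMonoidHom.comp Abelianization.of).comp ρ)
    ((φ.surjective.comp (QuotientGroup.mk'_surjective _)).comp hρ) (by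
      intro g hg h
      rw [← hcc]
      refine Subgroup.commutator_mem_commutator ?_ (Subgroup.mem_top h)
      rw [MonoidHom.mem_ker] at hg
      have h1 : φ (Abelianization.of (ρ g)) = 1 := hg
      rw [map_eq_one_iff φ φ.injective] at h1
      exact (QuotientGroup.eq_one_iff (N := commutator G) (ρ g)).1 h1)
    (fun i => Pi.mulSingle i (Multiplicative.ofAdd 1)) e (gens_pi _) (by
      intro i
      rw [← Pi.mulSingle_pow, ← ofAdd_nsmul]
      simp)
  set T := ∑ q : {q : ι × ι // q.1 < q.2}, min (e q.1.1) (e q.1.2) with hT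
  have hcardE : schurCard G * p ^ (k' + 1) = Nat.card (commutator E) := by
    rw [← hk]; exact hopf_mul π hπ
  have hle : schurCard G * p ^ (k' + 1) ≤ p ^ (k' * (d' + 1) + 2 + T) := by
    rw [hcardE, gamma_mul, pow_add]
    exact Nat.mul_le_mul hg3 hg2
  have hexp : (d' + 1 - 1) * (n + (k' + 1) - 2) + 2 + 2 * (k' + 1) ≤
      2 * (k' * (d' + 1) + 2 + T) := by
    rw [← Nat.pow_le_pow_iff_right hp.one_lt, pow_add, ← hM]
    calc schurCard G ^ 2 * p ^ (2 * (k' + 1)) = (schurCard G * p ^ (k' + 1)) ^ 2 := by ring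
      _ ≤ (p ^ (k' * (d' + 1) + 2 + T)) ^ 2 := Nat.pow_le_pow_left hle 2
      _ = _ := by ring
  have hsimp : n + (k' + 1) - 2 = N + 2 * k' := by omega
  rw [hsimp, Nat.add_sub_cancel] at hexp
  have hTN : d' * N ≤ 2 * T := by nlinarith
  have hps := pairs_sum e
  rw [← hT, ← hN] at hps
  obtain ⟨hms1, hms2⟩ := min_sum_le e
  rw [← hN] at hms1 hms2
  have hcard : Fintype.card ι = d' + 1 := by
    refine le_antisymm hrank ?_
    by_contra hcon
    have h1 : Fintype.card ι ≤ d' := by omega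
    have h2 : Fintype.card ι * N ≤ d' * N := Nat.mul_le_mul_right _ h1
    omega
  have heq := hms2 (by
    rw [hcard] at hms1 ⊢
    have : (d' + 1) * N = d' * N + N := by ring
    omega)
  obtain ⟨i0⟩ := Fintype.card_pos_iff.1 hrpos
  obtain ⟨c, hc⟩ : ∃ c, e = fun _ => c := ⟨e i0, funext fun i => heq i i0⟩
  clear_value T N
  subst hc
  refine ⟨c, he1 i0, ⟨φ.trans ?_⟩⟩
  exact MulEquiv.arrowCongr (Fintype.equivFinOfCardEq hcard) (MulEquiv.refl _)
end

section
/- Let p be a prime and let G be a non-abelian finite p-group of order p^n with commutator subgroup G' of order p^k where k ≥ 2, and let d = d(G). If |M(G)| attains the bound, i.e. |M(G)| = p^{(1/2)(d-1)(n+k-2)+1}, then 2 ≤ d ≤ 3. -/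
namespace SchurAux
open Subgroup
open scoped commutatorElement

variable {F : Type*} [Group F]

/-- Elements commuting with `x` modulo `N`. -/
def Cz (N : Subgroup F) [N.Normal] (x : F) : Subgroup F :=
  (centralizer {(QuotientGroup.mk' N x)}).comap (QuotientGroup.mk' N)

lemma mk_comm_eq_one_iff (N : Subgroup F) [N.Normal] (f x : F) :
    ⁅QuotientGroup.mk' N f, QuotientGroup.mk' N x⁆ = 1 ↔ ⁅f, x⁆ ∈ N := by
  rw [← map_commutatorElement]
  exact QuotientGroup.eq_one_iff _

lemma mem_Cz {N : Subgroup F} [N.Normal] {x f : F} : f ∈ Cz N x ↔ ⁅f, x⁆ ∈ N := by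
  rw [Cz, mem_comap, mem_centralizer_singleton_iff, ← mk_comm_eq_one_iff,
    commutatorElement_eq_one_iff_mul_comm]

lemma comm_mem_symm {N : Subgroup F} {x f : F} (h : ⁅f, x⁆ ∈ N) : ⁅x, f⁆ ∈ N := by
  rw [← commutatorElement_inv]; exact N.inv_mem h

lemma mem_Cz' {N : Subgroup F} [N.Normal] {x f : F} : f ∈ Cz N x ↔ ⁅x, f⁆ ∈ N :=
  mem_Cz.trans ⟨comm_mem_symm, comm_mem_symm⟩

lemma le_Cz (N : Subgroup F) [N.Normal] (x : F) : N ≤ Cz N x := by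
  intro f hf
  rw [mem_Cz, commutatorElement_def]
  have : f * x * f⁻¹ * x⁻¹ = f * (x * f⁻¹ * x⁻¹) := by group
  rw [this]
  exact N.mul_mem hf (Normal.conj_mem inferInstance _ (N.inv_mem hf) x)

/-- Elements central modulo `N`. -/
def Zt (N : Subgroup F) [N.Normal] : Subgroup F :=
  (center (F ⧸ N)).comap (QuotientGroup.mk' N)

instance (N : Subgroup F) [N.Normal] : (Zt N).Normal := by
  unfold Zt; infer_instance

lemma mem_Zt {N : Subgroup F} [N.Normal] {f : F} : f ∈ Zt N ↔ ∀ g, ⁅f, g⁆ ∈ N := by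
  rw [Zt, mem_comap, mem_center_iff]
  constructor
  · intro h g
    rw [← mk_comm_eq_one_iff, commutatorElement_eq_one_iff_mul_comm]
    exact (h _).symm
  · intro h g
    obtain ⟨g, rfl⟩ := QuotientGroup.mk'_surjective N g
    have := h g
    rw [← mk_comm_eq_one_iff, commutatorElement_eq_one_iff_mul_comm] at this
    exact this.symm

lemma comm_le_iff {S N : Subgroup F} [N.Normal] : ⁅S, (⊤ : Subgroup F)⁆ ≤ N ↔ S ≤ Zt N := by
  rw [commutator_le]
  constructor
  · intro h f hf; rw [mem_Zt]; intro g; exact h f hf g trivial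
  · intro h f hf g _; exact mem_Zt.1 (h hf) g

/-- image of `R` in `F/[R,F]` is central -/
lemma mk_mem_center (R : Subgroup F) [R.Normal] {r : F} (hr : r ∈ R) :
    QuotientGroup.mk' ⁅R, (⊤ : Subgroup F)⁆ r ∈ center (F ⧸ ⁅R, (⊤ : Subgroup F)⁆) :=
  (comm_le_iff (S := R) (N := ⁅R, (⊤ : Subgroup F)⁆)).1 le_rfl hr

/-- Hall-Witt -/
lemma hall_witt (R : Subgroup F) [R.Normal] {x y z : F} (hx : ⁅z, x⁆ ∈ R) (hy : ⁅z, y⁆ ∈ R) :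
    ⁅z, ⁅x, y⁆⁆ ∈ ⁅R, (⊤ : Subgroup F)⁆ := by
  rw [← mk_comm_eq_one_iff, map_commutatorElement]
  have h1 := mk_mem_center R hx
  have h2 := mk_mem_center R hy
  rw [map_commutatorElement] at h1 h2
  generalize QuotientGroup.mk' ⁅R, (⊤ : Subgroup F)⁆ x = x at *
  generalize QuotientGroup.mk' ⁅R, (⊤ : Subgroup F)⁆ y = y at *
  generalize QuotientGroup.mk' ⁅R, (⊤ : Subgroup F)⁆ z = z at *
  rw [mem_center_iff] at h1 h2
  have e1 : z * x * z⁻¹ = ⁅z, x⁆ * x := by simp [commutatorElement_def]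
  have e2 : z * y * z⁻¹ = ⁅z, y⁆ * y := by simp [commutatorElement_def]
  generalize ⁅z, x⁆ = a at *
  generalize ⁅z, y⁆ = b at *
  have key : z * ⁅x, y⁆ * z⁻¹ = ⁅a * x, b * y⁆ := by
    rw [← e1, ← e2]; simp only [commutatorElement_def]; group
  have key2 : ⁅a * x, b * y⁆ = ⁅x, y⁆ := by
    have ca : ∀ g, Commute a g := fun g => (h1 g).symm
    have cb : ∀ g, Commute b g := fun g => (h2 g).symm
    simp only [commutatorElement_def, mul_inv_rev]
    calc a * x * (b * y) * (x⁻¹ * a⁻¹) * (y⁻¹ * b⁻¹)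
        = a * (x * b) * y * x⁻¹ * (a⁻¹ * y⁻¹) * b⁻¹ := by group
      _ = a * (b * x) * y * x⁻¹ * (y⁻¹ * a⁻¹) * b⁻¹ := by
          rw [h2 x, ((ca y⁻¹).inv_left).eq]
      _ = (a * b) * (x * y * x⁻¹ * y⁻¹) * (a⁻¹ * b⁻¹) := by group
      _ = (x * y * x⁻¹ * y⁻¹) * (a * b) * (a⁻¹ * b⁻¹) := by
          rw [((ca _).mul_left (cb _)).eq]
      _ = x * y * x⁻¹ * y⁻¹ := by rw [(ca b).eq]; group
  rw [commutatorElement_def, key, key2]; exact mul_inv_cancel _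

/-- The commutator map `f ↦ [s,f]` modulo `[R,F]`. -/
def kap (R : Subgroup F) [R.Normal] (s : F) (hs : ∀ f, ⁅s, f⁆ ∈ R) :
    F →* F ⧸ ⁅R, (⊤ : Subgroup F)⁆ where
  toFun f := QuotientGroup.mk' _ ⁅s, f⁆
  map_one' := by simp
  map_mul' f g := by
    have h1 := mem_center_iff.1 (mk_mem_center R (hs g))
    have : ⁅s, f * g⁆ = ⁅s, f⁆ * (f * ⁅s, g⁆ * f⁻¹) := by
      simp only [commutatorElement_def]; group
    rw [this, map_mul, map_mul, map_mul, h1, map_inv, mul_inv_cancel_right]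

lemma mem_ker_kap (R : Subgroup F) [R.Normal] (s : F) (hs : ∀ f, ⁅s, f⁆ ∈ R) (f : F) :
    f ∈ (kap R s hs).ker ↔ ⁅s, f⁆ ∈ ⁅R, (⊤ : Subgroup F)⁆ := by
  rw [MonoidHom.mem_ker]
  exact QuotientGroup.eq_one_iff _

lemma kap_range_center (R : Subgroup F) [R.Normal] (s : F) (hs : ∀ f, ⁅s, f⁆ ∈ R) :
    (kap R s hs).range ≤ center _ := by
  rintro _ ⟨f, rfl⟩
  exact mk_mem_center R (hs f)

lemma relIndex_le (R S : Subgroup F) [R.Normal] [S.Normal] (s : F) (hs : ∀ f, ⁅s, f⁆ ∈ R)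
    (hS : S ≤ R ⊔ zpowers s) (C : Subgroup F) (hC0 : C.index ≠ 0)
    (hC : ∀ c ∈ C, ⁅s, c⁆ ∈ ⁅R, (⊤ : Subgroup F)⁆) :
    ⁅R, (⊤ : Subgroup F)⁆.relIndex ⁅S, (⊤ : Subgroup F)⁆ ≤ C.index := by
  have hle : C ≤ (kap R s hs).ker := fun c hc => (mem_ker_kap R s hs c).2 (hC c hc)
  have : C.FiniteIndex := ⟨hC0⟩
  refine le_trans ?_ (index_antitone hle)
  have : (kap R s hs).ker.FiniteIndex := finiteIndex_of_le hle
  rw [index_ker]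
  have hfin : Finite (kap R s hs).range := by
    have h : (kap R s hs).ker.index ≠ 0 := FiniteIndex.index_ne_zero
    rw [index_ker] at h
    exact (Nat.card_ne_zero.1 h).2
  have : (kap R s hs).range.Normal := by
    constructor
    intro n hn g
    have := mem_center_iff.1 (kap_range_center R s hs hn) g
    rw [this, mul_inv_cancel_right]; exact hn
  have e : ⁅R, (⊤ : Subgroup F)⁆.relIndex ⁅S, (⊤ : Subgroup F)⁆ =
      Nat.card (⁅S, (⊤ : Subgroup F)⁆.map (QuotientGroup.mk' ⁅R, (⊤ : Subgroup F)⁆)) := by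
    rw [← relIndex_ker, QuotientGroup.ker_mk']
  rw [e]
  refine Subgroup.card_le_of_le ?_
  rw [map_le_iff_le_comap]
  rw [comm_le_iff]
  refine hS.trans (sup_le ?_ ?_)
  · intro r hr
    rw [mem_Zt]
    intro g
    rw [mem_comap]
    have : QuotientGroup.mk' ⁅R, (⊤ : Subgroup F)⁆ ⁅r, g⁆ = 1 :=
      (QuotientGroup.eq_one_iff _).2 (commutator_mem_commutator hr trivial)
    rw [this]; exact one_mem _
  · rw [zpowers_le, mem_Zt]
    intro g
    rw [mem_comap]
    exact ⟨g, rfl⟩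

/-- generic kernel elements -/
lemma frat_le (p : ℕ) (R : Subgroup F) [R.Normal] (s : F) (hs : ∀ f, ⁅s, f⁆ ∈ R)
    (hsp : s ^ p ∈ R) :
    R ⊔ commutator F ⊔ closure (Set.range fun f : F => f ^ p) ≤ (kap R s hs).ker := by
  refine sup_le (sup_le ?_ ?_) ?_
  · intro r hr
    rw [mem_ker_kap]
    exact comm_mem_symm (commutator_mem_commutator hr trivial)
  · rw [_root_.commutator_def, commutator_le]
    intro f _ g _
    rw [MonoidHom.mem_ker, map_commutatorElement, commutatorElement_eq_one_iff_mul_comm]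
    exact (mem_center_iff.1 (kap_range_center R s hs ⟨f, rfl⟩) _).symm
  · rw [closure_le]
    rintro _ ⟨g, rfl⟩
    show g ^ p ∈ (kap R s hs).ker
    rw [MonoidHom.mem_ker, map_pow]
    have h1 := kap_range_center R s hs ⟨g, rfl⟩
    have h2 := mk_mem_center R hsp
    have h3 : kap R s hs g = ⁅QuotientGroup.mk' ⁅R, (⊤ : Subgroup F)⁆ s,
        QuotientGroup.mk' ⁅R, (⊤ : Subgroup F)⁆ g⁆ := by
      rw [← map_commutatorElement]; rfl
    rw [map_pow] at h2
    rw [h3] at h1 ⊢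
    generalize QuotientGroup.mk' ⁅R, (⊤ : Subgroup F)⁆ s = t at *
    generalize QuotientGroup.mk' ⁅R, (⊤ : Subgroup F)⁆ g = u at *
    rw [mem_center_iff] at h1 h2
    have e1 : u * t⁻¹ * u⁻¹ = t⁻¹ * ⁅t, u⁆ := by simp [commutatorElement_def, mul_assoc]
    have e2 : (u * t⁻¹ * u⁻¹) ^ p = t⁻¹ ^ p := by
      rw [conj_pow, inv_pow]
      have := h2 u
      rw [mul_inv_eq_iff_eq_mul, mul_inv_eq_iff_eq_mul, mul_assoc, this]; simp
    rw [e1, (show Commute t⁻¹ ⁅t, u⁆ from h1 _).mul_pow] at e2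
    exact mul_eq_left.1 e2

lemma Cz_index_le (N K : Subgroup F) [N.Normal] (x : F) (hK : ∀ f : F, ⁅f, x⁆ ∈ K)
    (h0 : N.relIndex K ≠ 0) : (Cz N x).index ≤ N.relIndex K := by
  have e : N.relIndex K = Nat.card (K.map (QuotientGroup.mk' N)) := by
    rw [← relIndex_ker, QuotientGroup.ker_mk']
  rw [e] at h0 ⊢
  have := (Nat.card_ne_zero.1 h0).2
  rw [index_eq_card]
  have hwd : ∀ a b : F, a⁻¹ * b ∈ Cz N x ↔
      QuotientGroup.mk' N ⁅a, x⁆ = QuotientGroup.mk' N ⁅b, x⁆ := by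
    intro a b
    rw [Cz, mem_comap, mem_centralizer_singleton_iff, map_commutatorElement,
      map_commutatorElement, map_mul, map_inv]
    generalize QuotientGroup.mk' N a = a
    generalize QuotientGroup.mk' N b = b
    generalize QuotientGroup.mk' N x = x
    simp only [commutatorElement_def]
    constructor
    · intro h
      have : b * x * b⁻¹ = a * x * a⁻¹ := by
        calc b * x * b⁻¹ = a * ((a⁻¹ * b) * x) * b⁻¹ := by group
          _ = _ := by rw [h]; group
      rw [this]
    · intro h
      have h := mul_right_cancel h
      calc (a⁻¹ * b) * x = a⁻¹ * (b * x * b⁻¹) * b := by group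
          _ = _ := by rw [← h]; group
  refine Nat.card_le_card_of_injective (fun q : F ⧸ Cz N x =>
    (Quotient.liftOn' q (fun f => (⟨QuotientGroup.mk' N ⁅f, x⁆, ⟨_, hK f, rfl⟩⟩ :
      K.map (QuotientGroup.mk' N))) ?_)) ?_
  · intro a b hab
    rw [QuotientGroup.leftRel_apply] at hab
    exact Subtype.ext ((hwd a b).1 hab)
  · intro a b
    induction a using QuotientGroup.induction_on
    induction b using QuotientGroup.induction_on
    intro h
    rw [QuotientGroup.eq, hwd]
    exact congrArg Subtype.val h

/-- strict inclusions of subgroups of `p`-power index have relative index at least `p` -/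
lemma le_relIndex {p n : ℕ} (hp : p.Prime) {R H K : Subgroup F} (hR : R.index = p ^ n)
    (hRH : R ≤ H) (hHK : H ≤ K) {x : F} (hx : x ∈ K) (hx' : x ∉ H) : p ≤ H.relIndex K := by
  have h1 : H.relIndex K ∣ p ^ n :=
    (relIndex_dvd_index_of_le hHK).trans (hR ▸ index_dvd_of_le hRH)
  obtain ⟨m, _, hm⟩ := (Nat.dvd_prime_pow hp).1 h1
  rw [hm]
  rcases Nat.eq_zero_or_pos m with rfl | h
  · rw [pow_zero, relIndex_eq_one] at hm
    exact absurd (hm hx) hx'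
  · exact Nat.le_self_pow h.ne' p

lemma eq_top_of {p n : ℕ} (hp : p.Prime) {R S D C : Subgroup F} [S.Normal]
    (hR : R.index = p ^ n) {x y : F} (hxy : ⁅x, y⁆ ∉ S) (hRD : R ≤ D)
    (hDx : D ≤ Cz S x) (hDy : D ≤ Cz S y) (hD : D.index ≤ p * p)
    (hDC : D ≤ C) (hx : x ∈ C) (hy : y ∈ C) : C = ⊤ := by
  have h1 : p ≤ D.relIndex (C ⊓ Cz S x) := by
    refine le_relIndex hp hR hRD (le_inf hDC hDx) (x := x) ⟨hx, ?_⟩ ?_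
    · show x ∈ Cz S x; rw [mem_Cz]; simp [one_mem]
    · intro h; exact hxy (mem_Cz.1 (hDy h))
  have h2 : p ≤ (C ⊓ Cz S x).relIndex C := by
    refine le_relIndex hp hR (hRD.trans (le_inf hDC hDx)) inf_le_left (x := y) hy ?_
    intro h; exact hxy (mem_Cz'.1 h.2)
  have h3 := relIndex_mul_relIndex _ _ _ (le_inf hDC hDx) (inf_le_left : C ⊓ Cz S x ≤ C)
  have h4 := relIndex_mul_index hDC
  have h5 : C.index ≠ 0 := by
    intro h
    rw [h, mul_zero] at h4
    have := index_dvd_of_le hRD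
    rw [← h4, hR, zero_dvd_iff] at this
    exact (pow_pos hp.pos n).ne' this
  rw [← index_eq_one]
  have hpp : 0 < p * p := Nat.mul_pos hp.pos hp.pos
  have h6 : p * p ≤ D.relIndex C := by rw [← h3]; exact Nat.mul_le_mul h1 h2
  have h7 : p * p * C.index ≤ p * p * 1 := by
    calc p * p * C.index ≤ D.relIndex C * C.index := Nat.mul_le_mul_right _ h6
      _ ≤ p * p * 1 := by rw [h4, mul_one]; exact hD
  have := Nat.le_of_mul_le_mul_left h7 hpp
  omega

end SchurAux

namespace SchurAux
open Subgroup
open scoped commutatorElement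

variable {F : Type*} [Group F]

lemma card_sup_le {E : Type*} [Group E] (H K : Subgroup E) [K.Normal] (hH : Nat.card H ≠ 0)
    (hK : Nat.card K ≠ 0) :
    Nat.card (H ⊔ K : Subgroup E) ≠ 0 ∧ Nat.card (H ⊔ K : Subgroup E) ≤ Nat.card H * Nat.card K := by
  have h1 := relIndex_mul_relIndex ⊥ K (H ⊔ K) bot_le le_sup_right
  rw [relIndex_bot_left, relIndex_bot_left, relIndex_sup_right] at h1
  have h2 : K.relIndex H ∣ Nat.card H := relIndex_dvd_card K H
  rw [← h1]
  refine ⟨mul_ne_zero hK (ne_zero_of_dvd_ne_zero hH h2), ?_⟩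
  rw [mul_comm]
  exact Nat.mul_le_mul_right _ (Nat.le_of_dvd (Nat.pos_of_ne_zero hH) h2)

lemma normal_of_le_center {E : Type*} [Group E] {M : Subgroup E} (h : M ≤ center E) :
    M.Normal := by
  constructor
  intro n hn g
  have := mem_center_iff.1 (h hn) g
  rw [this, mul_inv_cancel_right]; exact hn

lemma card_biSup_le {E α : Type*} [Group E] (H : α → Subgroup E) (hc : ∀ a, H a ≤ center E)
    (h0 : ∀ a, Nat.card (H a) ≠ 0) (s : Finset α) :
    Nat.card (⨆ a ∈ s, H a : Subgroup E) ≠ 0 ∧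
      Nat.card (⨆ a ∈ s, H a : Subgroup E) ≤ ∏ a ∈ s, Nat.card (H a) := by
  classical
  induction s using Finset.induction_on with
  | empty => simp
  | insert a s ha ih =>
    rw [Finset.iSup_insert, Finset.prod_insert ha]
    have : (⨆ a ∈ s, H a : Subgroup E).Normal :=
      normal_of_le_center (iSup_le fun a => iSup_le fun _ => hc a)
    obtain ⟨h1, h2⟩ := card_sup_le (H a) (⨆ a ∈ s, H a) (h0 a) ih.1
    exact ⟨h1, h2.trans (Nat.mul_le_mul_left _ ih.2)⟩

lemma prod_pairs {ι : Type*} [Fintype ι] [LinearOrder ι] (n : ι → ℕ) :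
    ∏ q ∈ (Finset.univ.filter fun q : ι × ι => q.1 < q.2), (n q.1 * n q.2) =
      (∏ i, n i) ^ (Fintype.card ι - 1) := by
  rw [Finset.prod_filter, Fintype.prod_prod_type, ← Finset.prod_pow]
  have : ∀ i j : ι, (if i < j then n i * n j else 1) =
      (if i < j then n i else 1) * (if i < j then n j else 1) := by
    intro i j; split_ifs <;> simp
  simp only [this, Finset.prod_mul_distrib]
  rw [Finset.prod_comm (f := fun i j => if i < j then n j else 1), ← Finset.prod_mul_distrib]
  refine Finset.prod_congr rfl fun i _ => ?_
  rw [← Finset.prod_mul_distrib]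
  have h2 : ∀ j : ι, (if i < j then n i else 1) * (if j < i then n i else 1) =
      if j ∈ (Finset.univ.erase i) then n i else 1 := by
    intro j
    rcases lt_trichotomy i j with h | h | h
    · simp [h, h.ne', h.not_gt]
    · simp [h]
    · simp [h, h.ne, h.not_gt]
  rw [Finset.prod_congr rfl fun j _ => h2 j, Finset.prod_ite_mem]
  simp [Finset.card_erase_of_mem]

lemma comm_bound {ι : Type*} [Fintype ι] [LinearOrder ι] (T : Subgroup F) [T.Normal]
    (hT : commutator F ≤ T) (x : ι → F) (n : ι → ℕ) (hn : ∀ i, 0 < n i)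
    (hx : ∀ i, x i ^ n i ∈ T) (hgen : closure (Set.range x) ⊔ T = ⊤) :
    ⁅T, (⊤ : Subgroup F)⁆.relIndex (commutator F) ≠ 0 ∧
    (⁅T, (⊤ : Subgroup F)⁆.relIndex (commutator F)) ^ 2 ≤
      (∏ i, n i) ^ (Fintype.card ι - 1) := by
  have hs : ∀ a f : F, ⁅a, f⁆ ∈ T := fun a f =>
    hT (by rw [_root_.commutator_def]; exact commutator_mem_commutator trivial trivial)
  set q := QuotientGroup.mk' ⁅T, (⊤ : Subgroup F)⁆ with hq
  let H : ι × ι → Subgroup (F ⧸ ⁅T, (⊤ : Subgroup F)⁆) := fun a => zpowers (q ⁅x a.1, x a.2⁆)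
  have hc : ∀ a, H a ≤ center _ := fun a => by
    rw [zpowers_le]; exact mk_mem_center T (hs _ _)
  have hpow : ∀ i j, q ⁅x i, x j⁆ ^ n j = 1 := by
    intro i j
    have : kap T (x i) (hs _) (x j ^ n j) = 1 := by
      rw [← MonoidHom.mem_ker, mem_ker_kap]
      exact comm_mem_symm (commutator_mem_commutator (hx j) trivial)
    rw [map_pow] at this
    exact this
  have hpow' : ∀ i j, q ⁅x i, x j⁆ ^ n i = 1 := by
    intro i j
    rw [← commutatorElement_inv, map_inv, inv_pow, hpow, inv_one]
  have hcard : ∀ a, Nat.card (H a) ≠ 0 ∧ Nat.card (H a) ^ 2 ≤ n a.1 * n a.2 := by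
    intro a
    have e : Nat.card (H a) = orderOf (q ⁅x a.1, x a.2⁆) := Nat.card_zpowers _
    rw [e]
    have d1 := orderOf_dvd_of_pow_eq_one (hpow' a.1 a.2)
    have d2 := orderOf_dvd_of_pow_eq_one (hpow a.1 a.2)
    refine ⟨ne_zero_of_dvd_ne_zero (hn a.1).ne' d1, ?_⟩
    rw [sq]
    exact Nat.mul_le_mul (Nat.le_of_dvd (hn _) d1) (Nat.le_of_dvd (hn _) d2)
  set s := (Finset.univ.filter fun q : ι × ι => q.1 < q.2) with hsdef
  set M : Subgroup (F ⧸ ⁅T, (⊤ : Subgroup F)⁆) := ⨆ a ∈ s, H a with hM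
  obtain ⟨b1, b2⟩ := card_biSup_le H hc (fun a => (hcard a).1) s
  rw [← hM] at b1 b2
  have hMn : M.Normal := normal_of_le_center (iSup_le fun a => iSup_le fun _ => hc a)
  have hTN : T ≤ Zt (M.comap q) := by
    intro t ht
    rw [mem_Zt]
    intro g
    rw [mem_comap]
    have : q ⁅t, g⁆ = 1 :=
      (QuotientGroup.eq_one_iff _).2 (commutator_mem_commutator ht trivial)
    rw [this]; exact one_mem _
  have hlt : ∀ i j, i < j → ⁅x i, x j⁆ ∈ M.comap q := by
    intro i j hij
    rw [mem_comap]
    have : H (i, j) ≤ M := le_biSup H (by simp [hsdef, hij] : (i, j) ∈ s)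
    exact this (mem_zpowers _)
  have hall : ∀ i j, ⁅x i, x j⁆ ∈ M.comap q := by
    intro i j
    rcases lt_trichotomy i j with h | h | h
    · exact hlt i j h
    · subst h; rw [commutatorElement_self]; exact one_mem _
    · exact comm_mem_symm (hlt j i h)
  have hxi : ∀ i, x i ∈ Zt (M.comap q) := by
    intro i
    rw [mem_Zt]
    have : (⊤ : Subgroup F) ≤ Cz (M.comap q) (x i) := by
      refine hgen.ge.trans (sup_le ?_ ?_)
      · rw [closure_le]
        rintro _ ⟨j, rfl⟩
        exact mem_Cz.2 (hall j i)
      · intro t ht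
        exact mem_Cz.2 (mem_Zt.1 (hTN ht) _)
    intro g
    exact mem_Cz'.1 (this (mem_top g))
  have htop : (⊤ : Subgroup F) ≤ Zt (M.comap q) := by
    refine hgen.ge.trans (sup_le ?_ hTN)
    rw [closure_le]
    rintro _ ⟨j, rfl⟩
    exact hxi j
  have hle : (commutator F).map q ≤ M := by
    rw [map_le_iff_le_comap, _root_.commutator_def, comm_le_iff]
    exact htop
  have e : ⁅T, (⊤ : Subgroup F)⁆.relIndex (commutator F) = Nat.card ((commutator F).map q) := by
    rw [← relIndex_ker, QuotientGroup.ker_mk']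
  have hMf : Finite M := (Nat.card_ne_zero.1 b1).2
  have b3 := Subgroup.card_le_of_le hle
  have hf : Finite ((commutator F).map q) := Finite.of_injective _ (Subgroup.inclusion_injective hle)
  rw [e]
  refine ⟨Nat.card_pos.ne', ?_⟩
  calc Nat.card ((commutator F).map q) ^ 2 ≤ (∏ a ∈ s, Nat.card (H a)) ^ 2 :=
        Nat.pow_le_pow_left (b3.trans b2) 2
    _ = ∏ a ∈ s, Nat.card (H a) ^ 2 := by rw [Finset.prod_pow]
    _ ≤ ∏ a ∈ s, (n a.1 * n a.2) := Finset.prod_le_prod' fun a _ => (hcard a).2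
    _ = _ := prod_pairs n

lemma abelian_bound {p m d : ℕ} (hp : p.Prime) (T : Subgroup F) [T.Normal]
    (hT : commutator F ≤ T) (hm : T.index = p ^ m)
    (hd : (T ⊔ closure (Set.range fun f : F => f ^ p)).index ≤ p ^ d) :
    ⁅T, (⊤ : Subgroup F)⁆.relIndex (commutator F) ≠ 0 ∧
    (⁅T, (⊤ : Subgroup F)⁆.relIndex (commutator F)) ^ 2 ≤ p ^ ((d - 1) * m) := by
  have hfi : T.FiniteIndex := ⟨by rw [hm]; exact (pow_pos hp.pos m).ne'⟩
  have hcomm : ∀ a b : F ⧸ T, a * b = b * a := by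
    intro a b
    obtain ⟨a, rfl⟩ := QuotientGroup.mk'_surjective T a
    obtain ⟨b, rfl⟩ := QuotientGroup.mk'_surjective T b
    rw [← commutatorElement_eq_one_iff_mul_comm, mk_comm_eq_one_iff]
    exact hT (by rw [_root_.commutator_def]; exact commutator_mem_commutator trivial trivial)
  let : CommGroup (F ⧸ T) := { QuotientGroup.Quotient.group T with mul_comm := hcomm }
  obtain ⟨ι, _, n, hn, ⟨e⟩⟩ := CommGroup.equiv_prod_multiplicative_zmod_of_finite (F ⧸ T)
  classical
  let : LinearOrder ι := LinearOrder.lift' (Fintype.equivFin ι) (Fintype.equivFin ι).injective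
  have hprod : ∏ i, n i = p ^ m := by
    rw [← hm, index_eq_card, Nat.card_congr e.toEquiv, Nat.card_pi]
    refine Finset.prod_congr rfl fun i _ => ?_
    exact (Nat.card_zmod (n i)).symm
  have hpn : ∀ i, p ∣ n i := by
    intro i
    have : n i ∣ p ^ m := hprod ▸ Finset.dvd_prod_of_mem n (Finset.mem_univ i)
    obtain ⟨a, _, ha⟩ := (Nat.dvd_prime_pow hp).1 this
    have := hn i
    rw [ha] at this ⊢
    refine dvd_pow_self p ?_
    rintro rfl
    simp at this
  let g : ι → F ⧸ T := fun i => e.symm (Pi.mulSingle i (Multiplicative.ofAdd 1))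
  have hg : ∀ i, ∃ x : F, QuotientGroup.mk' T x = g i := fun i => QuotientGroup.mk'_surjective T _
  choose x hx using hg
  have hxn : ∀ i, x i ^ n i ∈ T := by
    intro i
    rw [← QuotientGroup.eq_one_iff]
    have : QuotientGroup.mk' T (x i ^ n i) = 1 := by
      rw [map_pow, hx]
      show e.symm _ ^ _ = 1
      rw [← map_pow, ← Pi.mulSingle_pow, ← ofAdd_nsmul]
      simp
    exact this
  have hclo : closure (Set.range g) = ⊤ := by
    rw [eq_top_iff]
    intro y _
    obtain ⟨y, rfl⟩ := e.symm.surjective y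
    rw [← Finset.univ_prod_mulSingle y, map_prod]
    refine prod_mem fun i _ => ?_
    have : Pi.mulSingle i (y i) =
        (Pi.mulSingle i (Multiplicative.ofAdd 1) : (i : ι) → Multiplicative (ZMod (n i))) ^
          ((Multiplicative.toAdd (y i)).cast : ℤ) := by
      rw [← Pi.mulSingle_zpow, ← ofAdd_zsmul]
      simp
    rw [this, map_zpow]
    have hgi : g i ∈ closure (Set.range g) := Subgroup.subset_closure (Set.mem_range_self i)
    exact zpow_mem hgi _
  have hgen : closure (Set.range x) ⊔ T = ⊤ := by
    have h1 : (closure (Set.range x)).map (QuotientGroup.mk' T) = ⊤ := by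
      rw [MonoidHom.map_closure, ← Set.range_comp, ← hclo]
      congr 2
      funext i
      exact hx i
    have h2 := comap_map_eq (QuotientGroup.mk' T) (closure (Set.range x))
    rw [h1, comap_top, QuotientGroup.ker_mk'] at h2
    exact h2.symm
  obtain ⟨b1, b2⟩ := comm_bound T hT x n (fun i => (zero_lt_one.trans (hn i))) hxn hgen
  refine ⟨b1, b2.trans ?_⟩
  rw [hprod, ← pow_mul, mul_comm]
  refine Nat.pow_le_pow_right hp.pos (Nat.mul_le_mul_right _ (Nat.sub_le_sub_right ?_ 1))
  -- rank bound
  let ψ0 : ((i : ι) → Multiplicative (ZMod (n i))) →* (ι → Multiplicative (ZMod p)) :=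
    MonoidHom.pi fun i =>
      ((ZMod.castHom (hpn i) (ZMod p)).toAddMonoidHom.toMultiplicative).comp (Pi.evalMonoidHom _ i)
  have hψ0 : Function.Surjective ψ0 := by
    intro y
    have : ∀ i, ∃ z : ZMod (n i), ZMod.castHom (hpn i) (ZMod p) z = Multiplicative.toAdd (y i) :=
      fun i => ZMod.castHom_surjective (hpn i) _
    choose z hz using this
    refine ⟨fun i => Multiplicative.ofAdd (z i), ?_⟩
    funext i
    exact hz i
  let ψ : F →* (ι → Multiplicative (ZMod p)) := (ψ0.comp e.toMonoidHom).comp (QuotientGroup.mk' T)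
  have hψ : Function.Surjective ψ :=
    (hψ0.comp e.surjective).comp (QuotientGroup.mk'_surjective T)
  have hker : T ⊔ closure (Set.range fun f : F => f ^ p) ≤ ψ.ker := by
    refine sup_le ?_ ?_
    · intro t ht
      rw [MonoidHom.mem_ker]
      have : QuotientGroup.mk' T t = 1 := (QuotientGroup.eq_one_iff _).2 ht
      show ψ0 (e (QuotientGroup.mk' T t)) = 1
      rw [this, map_one, map_one]
    · rw [closure_le]
      rintro _ ⟨f, rfl⟩
      show f ^ p ∈ ψ.ker
      rw [MonoidHom.mem_ker, map_pow]
      funext i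
      show (ψ f i) ^ p = 1
      apply Multiplicative.toAdd.injective
      rw [toAdd_pow]
      simp
  have hfi2 : (T ⊔ closure (Set.range fun f : F => f ^ p)).FiniteIndex :=
    finiteIndex_of_le le_sup_left
  have h1 := index_antitone hker
  rw [index_ker, MonoidHom.range_eq_top.2 hψ, card_top, Nat.card_pi] at h1
  have h2 : ∀ i : ι, Nat.card (Multiplicative (ZMod p)) = p := fun i => Nat.card_zmod p
  rw [Finset.prod_congr rfl fun i _ => h2 i, Finset.prod_const, Finset.card_univ] at h1
  exact (Nat.pow_le_pow_iff_right hp.one_lt).1 (h1.trans hd)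

end SchurAux

namespace SchurAux
open Subgroup
open scoped commutatorElement

variable {F : Type*} [Group F]

lemma le_sup_zpowers {p : ℕ} (hp : p.Prime) {R S : Subgroup F} (hRS : R ≤ S)
    (h : R.relIndex S = p) {s : F} (hs : s ∈ S) (hsR : s ∉ R) : S ≤ R ⊔ zpowers s := by
  have hle : R ⊔ zpowers s ≤ S := sup_le hRS (by rwa [zpowers_le])
  have h1 := relIndex_mul_relIndex R (R ⊔ zpowers s) S le_sup_left hle
  rw [h] at h1
  rcases (Nat.dvd_prime hp).1 (Dvd.intro _ h1) with h2 | h2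
  · rw [relIndex_eq_one] at h2
    exact absurd (h2 (le_sup_right (a := R) (mem_zpowers s))) hsR
  · rw [h2] at h1
    have : (R ⊔ zpowers s).relIndex S = 1 := by
      have := hp.pos
      exact Nat.eq_of_mul_eq_mul_left this (by rw [h1, mul_one])
    rwa [relIndex_eq_one] at this

lemma pow_mem_of {p : ℕ} {R S : Subgroup F} [R.Normal]
    (h : R.relIndex S = p) {s : F} (hs : s ∈ S) : s ^ p ∈ R := by
  have := (R.subgroupOf S).pow_index_mem ⟨s, hs⟩
  rw [← relIndex, h, mem_subgroupOf] at this
  simpa using this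

lemma exists_step {p n k : ℕ} (hp : p.Prime) (R : Subgroup F) [R.Normal]
    (hR : R.index = p ^ n) (hk : R.relIndex (commutator F) = p ^ (k + 1)) :
    ∃ S : Subgroup F, S.Normal ∧ R ≤ S ∧ S ≤ R ⊔ commutator F ∧ S ≤ Zt R ∧ R.relIndex S = p ∧
      S.relIndex (commutator F) = p ^ k ∧ ∃ n', n = n' + 1 ∧ S.index = p ^ n' := by
  have : Fact p.Prime := ⟨hp⟩
  have hfi : R.FiniteIndex := ⟨by rw [hR]; exact (pow_pos hp.pos n).ne'⟩
  have hG : IsPGroup p (F ⧸ R) := IsPGroup.of_card (n := n) (by rw [← index_eq_card, hR])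
  set q := QuotientGroup.mk' R with hq
  have hqs : Function.Surjective q := QuotientGroup.mk'_surjective R
  have hker : ∀ K : Subgroup F, R.relIndex K = Nat.card (K.map q) := fun K => by
    rw [← relIndex_ker, QuotientGroup.ker_mk']
  have hNn : ((commutator F).map q).Normal := Normal.map inferInstance q hqs
  set N := (commutator F).map q with hN
  have hcard : p ∣ Nat.card N := by rw [← hker, hk]; exact dvd_pow_self p (Nat.succ_ne_zero k)
  have hGc : IsPGroup p (ConjAct (F ⧸ R)) := hG.of_equiv ConjAct.toConjAct
  obtain ⟨b, hb, hb1⟩ := hGc.exists_fixed_point_of_prime_dvd_card_of_fixed_point N hcard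
    (a := (1 : N)) (by intro g; simp)
  have hbc : (b : F ⧸ R) ∈ center (F ⧸ R) := by
    rw [mem_center_iff]
    intro g
    have := congrArg Subtype.val (hb (ConjAct.toConjAct g))
    rw [ConjAct.Subgroup.val_conj_smul, ConjAct.toConjAct_smul] at this
    exact mul_inv_eq_iff_eq_mul.1 this
  have hb1' : (b : F ⧸ R) ≠ 1 := fun h => hb1 (Subtype.ext h.symm)
  set c : F ⧸ R := (b : F ⧸ R) ^ (orderOf (b : F ⧸ R) / p) with hc
  have hcp : orderOf c = p := orderOf_pow_orderOf_div (orderOf_pos _).ne' (hG.dvd_orderOf hb1')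
  have hcc : c ∈ center (F ⧸ R) := pow_mem hbc _
  have hcN : c ∈ N := pow_mem b.2 _
  have hzn : (zpowers c).Normal := normal_of_le_center (by rwa [zpowers_le])
  have hRS : R ≤ (zpowers c).comap q := by
    intro r hr
    have : q r = 1 := (QuotientGroup.eq_one_iff _).2 hr
    rw [mem_comap, this]; exact one_mem _
  have hSF : (zpowers c).comap q ≤ R ⊔ commutator F := by
    have h1 : zpowers c ≤ N := by rwa [zpowers_le]
    have h2 := comap_mono (f := q) h1
    rwa [hN, comap_map_eq, QuotientGroup.ker_mk', sup_comm] at h2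
  have hRSp : R.relIndex ((zpowers c).comap q) = p := by
    rw [hker, map_comap_eq_self_of_surjective hqs, Nat.card_zpowers, hcp]
  refine ⟨(zpowers c).comap q, inferInstance, hRS, hSF, comap_mono (by rwa [zpowers_le]),
    hRSp, ?_, ?_⟩
  · have h1 := relIndex_mul_relIndex R _ _ hRS hSF
    rw [hRSp, relIndex_sup_left, hk] at h1
    have h2 : R ⊔ commutator F = (zpowers c).comap q ⊔ commutator F :=
      le_antisymm (sup_le_sup_right hRS _) (sup_le hSF le_sup_right)
    rw [h2, relIndex_sup_left, pow_succ, mul_comm] at h1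
    exact Nat.eq_of_mul_eq_mul_right hp.pos h1
  · have h1 := relIndex_mul_index hRS
    rw [hRSp, hR] at h1
    cases n with
    | zero =>
      rw [pow_zero] at h1
      exact absurd (Nat.dvd_one.1 (Dvd.intro _ h1)) hp.one_lt.ne'
    | succ n' =>
      refine ⟨n', rfl, ?_⟩
      rw [pow_succ, mul_comm] at h1
      exact Nat.eq_of_mul_eq_mul_right hp.pos h1

lemma sup_eq {R S : Subgroup F} (hRS : R ≤ S) (hSF : S ≤ R ⊔ commutator F) :
    S ⊔ commutator F = R ⊔ commutator F :=
  le_antisymm (sup_le hSF le_sup_right) (sup_le_sup_right hRS _)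

lemma comm_le_commutator (R : Subgroup F) : ⁅R, (⊤ : Subgroup F)⁆ ≤ commutator F := by
  rw [_root_.commutator_def]; exact commutator_mono le_top le_rfl

lemma exists_notMem {p : ℕ} (hp : p.Prime) {R S : Subgroup F} (h : R.relIndex S = p) :
    ∃ s ∈ S, s ∉ R := by
  by_contra hcon
  push Not at hcon
  have : R.relIndex S = 1 := relIndex_eq_one.2 hcon
  exact hp.one_lt.ne' (h.symm.trans this)

/-- general bound for one central step -/
lemma step_le {p d : ℕ} (hp : p.Prime) (R S : Subgroup F) [R.Normal] [S.Normal]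
    (hRS : R ≤ S) (hSZ : S ≤ Zt R) (h : R.relIndex S = p)
    (hd : (R ⊔ commutator F ⊔ closure (Set.range fun f : F => f ^ p)).index = p ^ d) :
    ⁅R, (⊤ : Subgroup F)⁆.relIndex ⁅S, (⊤ : Subgroup F)⁆ ≤ p ^ d := by
  obtain ⟨s, hs, hsR⟩ := exists_notMem hp h
  rw [← hd]
  refine relIndex_le R S s (mem_Zt.1 (hSZ hs)) (le_sup_zpowers hp hRS h hs hsR) _
    (by rw [hd]; exact (pow_pos hp.pos d).ne') ?_
  intro c hc
  exact (mem_ker_kap R s (mem_Zt.1 (hSZ hs)) c).1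
    (frat_le p R s (mem_Zt.1 (hSZ hs)) (pow_mem_of h hs) hc)

/-- a central step generated by a commutator -/
lemma step_comm_le {p N : ℕ} (hp : p.Prime) (R S : Subgroup F) [R.Normal] [S.Normal]
    (hRS : R ≤ S) (hSZ : S ≤ Zt R) (h : R.relIndex S = p) {u v : F} (huv : ⁅u, v⁆ ∈ S)
    (huv' : ⁅u, v⁆ ∉ R) (h0 : (Cz R u ⊓ Cz R v).index ≠ 0) (hN : (Cz R u ⊓ Cz R v).index ≤ N) :
    ⁅R, (⊤ : Subgroup F)⁆.relIndex ⁅S, (⊤ : Subgroup F)⁆ ≤ N := by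
  refine (relIndex_le R S ⁅u, v⁆ (mem_Zt.1 (hSZ huv)) (le_sup_zpowers hp hRS h huv huv') _
    h0 ?_).trans hN
  intro c hc
  exact comm_mem_symm (hall_witt R (mem_Cz.1 hc.1) (mem_Cz.1 hc.2))

lemma index_ne_zero_of_le' {p n : ℕ} (hp : p.Prime) {R H : Subgroup F} (hR : R.index = p ^ n)
    (h : R ≤ H) : H.index ≠ 0 := by
  have : R.FiniteIndex := ⟨by rw [hR]; exact (pow_pos hp.pos n).ne'⟩
  exact (finiteIndex_of_le h).index_ne_zero

lemma mem_comm (u v : F) : ⁅u, v⁆ ∈ commutator F := by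
  rw [_root_.commutator_def]; exact commutator_mem_commutator trivial trivial

lemma base_case {p n d : ℕ} (hp : p.Prime) (R : Subgroup F) [R.Normal]
    (hR : R.index = p ^ n) (hk : R.relIndex (commutator F) = p ^ 2)
    (hd : (R ⊔ commutator F ⊔ closure (Set.range fun f : F => f ^ p)).index = p ^ d)
    (hd4 : 4 ≤ d) :
    (⁅R, (⊤ : Subgroup F)⁆.relIndex (commutator F)) ^ 2 < p ^ ((d - 1) * n + 6) := by
  obtain ⟨S, hSn, hRS, hSF, hSZ, hRSp, hSk, n1, rfl, hSi⟩ := exists_step hp R hR hk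
  obtain ⟨T, hTn, hST, hTF, hTZ, hSTp, hTk, n2, rfl, hTi⟩ := exists_step hp S hSi hSk
  have hFT : commutator F ≤ T := by rwa [pow_zero, relIndex_eq_one] at hTk
  have hα : ⁅R, (⊤ : Subgroup F)⁆.relIndex ⁅S, (⊤ : Subgroup F)⁆ ≤ p ^ d :=
    step_le hp R S hRS hSZ hRSp hd
  have hTfr : T = R ⊔ commutator F :=
    le_antisymm (hTF.trans (sup_le hSF le_sup_right)) (sup_le (hRS.trans hST) hFT)
  obtain ⟨hγ0, hγ⟩ := abelian_bound (d := d) hp T hFT hTi (by rw [hTfr, hd])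
  have hsplit : ⁅R, (⊤ : Subgroup F)⁆.relIndex ⁅S, (⊤ : Subgroup F)⁆ *
      ⁅S, (⊤ : Subgroup F)⁆.relIndex ⁅T, (⊤ : Subgroup F)⁆ *
      ⁅T, (⊤ : Subgroup F)⁆.relIndex (commutator F) =
      ⁅R, (⊤ : Subgroup F)⁆.relIndex (commutator F) := by
    rw [mul_assoc, relIndex_mul_relIndex _ _ _ (commutator_mono hST le_rfl) (comm_le_commutator T),
      relIndex_mul_relIndex _ _ _ (commutator_mono hRS le_rfl) (comm_le_commutator S)]
  -- noncommuting elements mod S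
  obtain ⟨x, y, hxy⟩ : ∃ x y : F, ⁅x, y⁆ ∉ S := by
    by_contra hcon
    push Not at hcon
    have : commutator F ≤ S := by
      rw [_root_.commutator_def, commutator_le]
      exact fun a _ b _ => hcon a b
    rw [relIndex_eq_one.2 this] at hSk
    simp at hSk
    exact hp.one_lt.ne hSk
  have hSC : ∀ z, (Cz S z).index ≤ p := by
    intro z
    have := Cz_index_le S (commutator F) z (fun f => mem_comm f z)
      (by rw [hSk]; exact (pow_pos hp.pos _).ne')
    rw [hSk] at this
    simpa using this
  set D := Cz S x ⊓ Cz S y with hDdef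
  have hSD : S ≤ D := le_inf (le_Cz S x) (le_Cz S y)
  have hDi : D.index ≤ p * p := (index_inf_le (H := Cz S x) (K := Cz S y)).trans (Nat.mul_le_mul (hSC x) (hSC y))
  have hD0 : D.index ≠ 0 := index_ne_zero_of_le' hp hSi hSD
  have hβ : ⁅S, (⊤ : Subgroup F)⁆.relIndex ⁅T, (⊤ : Subgroup F)⁆ ≤ p * p :=
    step_comm_le hp S T hST hTZ hSTp (hFT (mem_comm x y)) hxy hD0 hDi
  have hαβ : ⁅R, (⊤ : Subgroup F)⁆.relIndex ⁅S, (⊤ : Subgroup F)⁆ *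
      ⁅S, (⊤ : Subgroup F)⁆.relIndex ⁅T, (⊤ : Subgroup F)⁆ ≤ p ^ (d + 1) := by
    by_cases hcase : ∃ x' ∈ D, ∃ y' ∈ D, ⁅x', y'⁆ ∉ S
    · -- rank at least four
      obtain ⟨x', hx', y', hy', hxy'⟩ := hcase
      have hCtop : Cz ⁅S, (⊤ : Subgroup F)⁆ ⁅x', y'⁆ = ⊤ := by
        refine eq_top_of hp hSi hxy hSD inf_le_left inf_le_right hDi ?_ ?_ ?_
        · intro f hf
          have h1 : S ⊔ zpowers ⁅x, y⁆ ≤ Cz ⁅S, (⊤ : Subgroup F)⁆ f := by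
            refine sup_le ?_ ?_
            · intro a ha
              exact mem_Cz.2 (commutator_mem_commutator ha trivial)
            · rw [zpowers_le]
              exact mem_Cz'.2 (hall_witt S (mem_Cz.1 hf.1) (mem_Cz.1 hf.2))
          have h2 := h1 (le_sup_zpowers hp hST hSTp (hFT (mem_comm x y)) hxy
            (hFT (mem_comm x' y')))
          exact mem_Cz'.2 (mem_Cz.1 h2)
        · exact mem_Cz.2 (hall_witt S (mem_Cz'.1 hx'.1) (mem_Cz'.1 hy'.1))
        · exact mem_Cz.2 (hall_witt S (mem_Cz'.1 hx'.2) (mem_Cz'.1 hy'.2))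
      have hβ1 : ⁅S, (⊤ : Subgroup F)⁆.relIndex ⁅T, (⊤ : Subgroup F)⁆ ≤ 1 := by
        have h1 := relIndex_le S T ⁅x', y'⁆ (mem_Zt.1 (hTZ (hFT (mem_comm x' y'))))
          (le_sup_zpowers hp hST hSTp (hFT (mem_comm x' y')) hxy') ⊤ (by simp) (by
            intro c _
            have : c ∈ Cz ⁅S, (⊤ : Subgroup F)⁆ ⁅x', y'⁆ := by rw [hCtop]; trivial
            exact mem_Cz'.1 this)
        simpa using h1
      calc _ ≤ p ^ d * 1 := Nat.mul_le_mul hα hβ1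
        _ ≤ p ^ (d + 1) := by rw [mul_one]; exact Nat.pow_le_pow_right hp.pos (Nat.le_succ d)
    · push Not at hcase
      have hDZ : D ≤ Zt S := by
        intro f hf
        have : Cz S f = ⊤ := by
          refine eq_top_of hp hSi hxy hSD inf_le_left inf_le_right hDi ?_ ?_ ?_
          · intro g hg; exact mem_Cz.2 (hcase g hg f hf)
          · exact mem_Cz'.2 (mem_Cz.1 hf.1)
          · exact mem_Cz'.2 (mem_Cz.1 hf.2)
        rw [mem_Zt]
        intro g
        have hg : g ∈ Cz S f := by rw [this]; trivial
        exact mem_Cz'.1 hg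
      have hRZ : R ≤ Zt R := hRS.trans hSZ
      have hnot : ¬ (Zt S ≤ Zt R) := by
        intro hle
        have hcl : commutator F ≤ Zt R := (hFT.trans hTZ).trans hle
        have hDR : D ≤ Zt R := hDZ.trans hle
        have hfi : D.FiniteIndex := ⟨hD0⟩
        have hZi : (Zt R).index ≤ p ^ 2 := by
          rw [sq]; exact (index_antitone hDR).trans hDi
        have hdvd : (Zt R).index ∣ p ^ (n2 + 1 + 1) := hR ▸ index_dvd_of_le hRZ
        obtain ⟨m, _, hm⟩ := (Nat.dvd_prime_pow hp).1 hdvd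
        have hm2 : m ≤ 2 := by
          rw [hm] at hZi; exact (Nat.pow_le_pow_iff_right hp.one_lt).1 hZi
        have hfi2 : (Zt R).FiniteIndex := ⟨index_ne_zero_of_le' hp hR hRZ⟩
        obtain ⟨c0, c1⟩ := abelian_bound (d := 2) hp (Zt R) hcl hm
          ((index_antitone le_sup_left).trans hZi)
        have hle2 : ⁅Zt R, (⊤ : Subgroup F)⁆ ≤ R := comm_le_iff.2 le_rfl
        have h3 := relIndex_le_of_le_left hle2 c0
        rw [hk] at h3
        have h4 : (p ^ 2) ^ 2 ≤ p ^ 2 := by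
          calc (p ^ 2) ^ 2 ≤ _ := Nat.pow_le_pow_left h3 2
            _ ≤ p ^ ((2 - 1) * m) := c1
            _ ≤ p ^ 2 := Nat.pow_le_pow_right hp.pos (by omega)
        rw [← pow_mul] at h4
        have := (Nat.pow_le_pow_iff_right hp.one_lt).1 h4
        omega
      obtain ⟨v, hvS, hvR⟩ := SetLike.not_le_iff_exists.1 hnot
      rw [mem_Zt] at hvS hvR
      push Not at hvR
      obtain ⟨u, hu⟩ := hvR
      have i1 : (Cz R v).index ≤ p := by
        have := Cz_index_le R S v (fun f => comm_mem_symm (hvS f)) (by rw [hRSp]; exact hp.ne_zero)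
        rwa [hRSp] at this
      have i2 : (Cz R u).index ≤ p ^ 2 := by
        have := Cz_index_le R (commutator F) u (fun f => mem_comm f u)
          (by rw [hk]; exact (pow_pos hp.pos 2).ne')
        rwa [hk] at this
      have hα3 : ⁅R, (⊤ : Subgroup F)⁆.relIndex ⁅S, (⊤ : Subgroup F)⁆ ≤ p * p ^ 2 := by
        refine step_comm_le hp R S hRS hSZ hRSp (hvS u) hu
          (index_ne_zero_of_le' hp hR (le_inf (le_Cz R v) (le_Cz R u))) ?_
        exact index_inf_le.trans (Nat.mul_le_mul i1 i2)
      calc _ ≤ (p * p ^ 2) * (p * p) := Nat.mul_le_mul hα3 hβ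
        _ = p ^ 5 := by ring
        _ ≤ p ^ (d + 1) := Nat.pow_le_pow_right hp.pos (by omega)
  rw [← hsplit, mul_pow]
  calc _ ≤ (p ^ (d + 1)) ^ 2 * p ^ ((d - 1) * n2) :=
        Nat.mul_le_mul (Nat.pow_le_pow_left hαβ 2) hγ
    _ = p ^ ((d + 1) * 2 + (d - 1) * n2) := by rw [← pow_mul, ← pow_add]
    _ < _ := by
      refine Nat.pow_lt_pow_right hp.one_lt ?_
      obtain ⟨e, rfl⟩ : ∃ e, d = e + 1 := ⟨d - 1, by omega⟩
      simp only [Nat.add_sub_cancel]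
      ring_nf
      omega

lemma main_bound {p d : ℕ} (hp : p.Prime) (hd4 : 4 ≤ d) (k : ℕ) : ∀ (n : ℕ) (R : Subgroup F),
    R.Normal → R.index = p ^ n → R.relIndex (commutator F) = p ^ (k + 2) →
    (R ⊔ commutator F ⊔ closure (Set.range fun f : F => f ^ p)).index = p ^ d →
    (⁅R, (⊤ : Subgroup F)⁆.relIndex (commutator F)) ^ 2 <
      p ^ ((d - 1) * (n + k) + 2 + 2 * (k + 2)) := by
  induction k with
  | zero =>
    intro n R hRn hR hk hd
    simpa using base_case hp R hR hk hd hd4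
  | succ k ih =>
    intro n R hRn hR hk hd
    obtain ⟨S, hSn, hRS, hSF, hSZ, hRSp, hSk, n1, rfl, hSi⟩ := exists_step hp R hR hk
    have hα : ⁅R, (⊤ : Subgroup F)⁆.relIndex ⁅S, (⊤ : Subgroup F)⁆ ≤ p ^ d :=
      step_le hp R S hRS hSZ hRSp hd
    have h2 := ih n1 S hSn hSi hSk (by rw [sup_eq hRS hSF, hd])
    rw [← relIndex_mul_relIndex _ _ _ (commutator_mono hRS le_rfl) (comm_le_commutator S), mul_pow]
    calc _ ≤ (p ^ d) ^ 2 * _ := Nat.mul_le_mul_right _ (Nat.pow_le_pow_left hα 2)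
      _ < (p ^ d) ^ 2 * p ^ ((d - 1) * (n1 + k) + 2 + 2 * (k + 2)) :=
        Nat.mul_lt_mul_of_pos_left h2 (pow_pos (pow_pos hp.pos d) 2)
      _ = _ := by
        rw [← pow_mul, ← pow_add]
        congr 1
        obtain ⟨e, rfl⟩ : ∃ e, d = e + 1 := ⟨d - 1, by omega⟩
        simp only [Nat.add_sub_cancel]
        ring

end SchurAux

namespace SchurAux
open Subgroup
open scoped commutatorElement

variable {G : Type*} [Group G]

lemma coatom_le {p n : ℕ} (hp : p.Prime) [Finite G] (hG : Nat.card G = p ^ n)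
    (M : Subgroup G) (hM : IsCoatom M) :
    commutator G ⊔ closure (Set.range fun f : G => f ^ p) ≤ M := by
  have : Fact p.Prime := ⟨hp⟩
  have hpG : IsPGroup p G := IsPGroup.of_card hG
  have hnil : Group.IsNilpotent G := hpG.isNilpotent
  have hMn : M.Normal :=
    NormalizerCondition.normal_of_coatom M Group.normalizerCondition_of_isNilpotent hM
  have hq : IsPGroup p (G ⧸ M) := hpG.to_quotient M
  have hnt : Nontrivial (G ⧸ M) := QuotientGroup.nontrivial_iff.2 hM.1
  have hcn : Nontrivial (center (G ⧸ M)) := hq.center_nontrivial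
  obtain ⟨b, hb⟩ := exists_ne (1 : center (G ⧸ M))
  have hb1 : (b : G ⧸ M) ≠ 1 := fun h => hb (Subtype.ext h)
  set c : G ⧸ M := (b : G ⧸ M) ^ (orderOf (b : G ⧸ M) / p) with hc
  have hcp : orderOf c = p := orderOf_pow_orderOf_div (orderOf_pos _).ne' (hq.dvd_orderOf hb1)
  have hle : M ≤ (zpowers c).comap (QuotientGroup.mk' M) := by
    intro r hr
    have : QuotientGroup.mk' M r = 1 := (QuotientGroup.eq_one_iff _).2 hr
    rw [mem_comap, this]; exact one_mem _
  have htop : (zpowers c).comap (QuotientGroup.mk' M) = ⊤ := by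
    rcases hM.le_iff.1 hle with h | h
    · exact h
    · exfalso
      have h1 : zpowers c = ⊥ := by
        rw [← map_comap_eq_self_of_surjective (QuotientGroup.mk'_surjective M) (zpowers c), h]
        exact QuotientGroup.map_mk'_self M
      rw [zpowers_eq_bot] at h1
      rw [h1, orderOf_one] at hcp
      exact hp.one_lt.ne hcp
  have hz : ∀ g : G, QuotientGroup.mk' M g ∈ zpowers c := fun g => by
    rw [← mem_comap, htop]; trivial
  refine sup_le ?_ ?_
  · rw [_root_.commutator_def, commutator_le]
    intro a _ b _
    rw [← mk_comm_eq_one_iff, commutatorElement_eq_one_iff_mul_comm]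
    obtain ⟨i, hi⟩ := hz a
    obtain ⟨j, hj⟩ := hz b
    rw [← hi, ← hj]
    exact (Commute.refl c).zpow_zpow i j
  · rw [closure_le]
    rintro _ ⟨f, rfl⟩
    obtain ⟨i, hi⟩ := hz f
    show f ^ p ∈ M
    rw [← QuotientGroup.eq_one_iff]
    show QuotientGroup.mk' M (f ^ p) = 1
    simp only at hi
    rw [map_pow, ← hi, ← zpow_natCast, ← zpow_mul, mul_comm, zpow_mul, zpow_natCast, ← hcp,
      pow_orderOf_eq_one, one_zpow]

lemma minGens_spec [Finite G] :
    ∃ S : Finset G, S.card = minGens G ∧ closure (S : Set G) = ⊤ := by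
  classical
  have := Fintype.ofFinite G
  have hne : {n | ∃ S : Finset G, S.card = n ∧ closure (S : Set G) = ⊤}.Nonempty :=
    ⟨_, Finset.univ, rfl, by simp⟩
  exact Nat.sInf_mem hne

lemma elem_add {p : ℕ} [Fact p.Prime] {A : Type*} [AddCommGroup A] [Finite A]
    [Module (ZMod p) A] :
    ∃ d' : ℕ, Nat.card A = p ^ d' ∧
      (∀ S : Finset A, AddSubgroup.closure (S : Set A) = ⊤ → d' ≤ S.card) ∧
      ∃ b : Fin d' → A, AddSubgroup.closure (Set.range b) = ⊤ := by
  have hmf : Module.Finite (ZMod p) A := Module.Finite.of_finite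
  refine ⟨Module.finrank (ZMod p) A, ?_, ?_, ?_⟩
  · have := Module.natCard_eq_pow_finrank (K := ZMod p) (V := A)
    rwa [Nat.card_zmod] at this
  · intro S hS
    have hspan : Submodule.span (ZMod p) (S : Set A) = ⊤ := by
      rw [eq_top_iff]
      intro v _
      have h1 : AddSubgroup.closure (S : Set A) ≤
          (Submodule.span (ZMod p) (S : Set A)).toAddSubgroup := by
        rw [AddSubgroup.closure_le]
        exact Submodule.subset_span
      exact h1 (by rw [hS]; trivial)
    have h3 := finrank_span_finset_le_card (R := ZMod p) S
    rwa [Set.finrank, hspan, finrank_top] at h3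
  · let b := Module.finBasis (ZMod p) A
    refine ⟨b, ?_⟩
    let W := AddSubgroup.toZModSubmodule p (AddSubgroup.closure (Set.range b))
    have hW : W = ⊤ := by
      rw [eq_top_iff, ← b.span_eq, Submodule.span_le]
      intro v hv
      exact AddSubgroup.subset_closure hv
    rw [eq_top_iff]
    intro v _
    have : v ∈ W := by rw [hW]; trivial
    exact this

lemma elem_mul {p : ℕ} [Fact p.Prime] {V : Type*} [Group V] [Finite V]
    (hc : ∀ a b : V, a * b = b * a) (h : ∀ a : V, a ^ p = 1) :
    ∃ d' : ℕ, Nat.card V = p ^ d' ∧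
      (∀ S : Finset V, closure (S : Set V) = ⊤ → d' ≤ S.card) ∧
      ∃ b : Fin d' → V, closure (Set.range b) = ⊤ := by
  let _ : AddCommGroup (Additive V) :=
    { (inferInstance : AddGroup (Additive V)) with add_comm := fun a b => hc a b }
  have hfin : Finite (Additive V) := inferInstanceAs (Finite V)
  let _ : Module (ZMod p) (Additive V) := AddCommGroup.zmodModule (fun a => h a)
  obtain ⟨d', h1, h2, b, h3⟩ := elem_add (p := p) (A := Additive V)
  refine ⟨d', h1, fun S hS => ?_, b, ?_⟩
  · refine h2 S ?_
    have := toAddSubgroup_closure (S : Set V)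
    rw [hS] at this
    exact this.symm.trans (map_top _)
  · have := toAddSubgroup_closure (Set.range b : Set V)
    apply (toAddSubgroup (G := V)).injective
    exact this.trans (h3.trans (map_top _).symm)

lemma burnside {p n : ℕ} (hp : p.Prime) [Finite G] (hG : Nat.card G = p ^ n) :
    (commutator G ⊔ closure (Set.range fun f : G => f ^ p)).index = p ^ (minGens G) := by
  classical
  have hpf : Fact p.Prime := ⟨hp⟩
  set P := commutator G ⊔ closure (Set.range fun f : G => f ^ p) with hP
  have hcP : commutator G ≤ P := le_sup_left
  have hPn : P.Normal := by
    constructor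
    intro a ha g
    have h1 : ⁅g, a⁆ ∈ P := hcP (mem_comm g a)
    have h2 : g * a * g⁻¹ = ⁅g, a⁆ * a := by simp [commutatorElement_def]
    rw [h2]; exact mul_mem h1 ha
  have hcomm : ∀ a b : G ⧸ P, a * b = b * a := by
    intro a b
    obtain ⟨a, rfl⟩ := QuotientGroup.mk'_surjective P a
    obtain ⟨b, rfl⟩ := QuotientGroup.mk'_surjective P b
    rw [← commutatorElement_eq_one_iff_mul_comm, mk_comm_eq_one_iff]
    exact hcP (mem_comm a b)
  have hpow : ∀ a : G ⧸ P, a ^ p = 1 := by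
    intro a
    obtain ⟨a, rfl⟩ := QuotientGroup.mk'_surjective P a
    rw [← map_pow]
    refine (QuotientGroup.eq_one_iff _).2 ?_
    exact (le_sup_right : _ ≤ P) (Subgroup.subset_closure ⟨a, rfl⟩)
  obtain ⟨d', hcard, hle, b, hb⟩ := elem_mul hcomm hpow
  rw [index_eq_card, hcard]
  congr 1
  apply le_antisymm
  · obtain ⟨S, hSc, hS⟩ := minGens_spec (G := G)
    rw [← hSc]
    refine (hle (S.image (QuotientGroup.mk' P)) ?_).trans Finset.card_image_le
    rw [Finset.coe_image, ← MonoidHom.map_closure, hS]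
    exact map_top_of_surjective _ (QuotientGroup.mk'_surjective P)
  · have hx : ∀ i, ∃ x : G, QuotientGroup.mk' P x = b i :=
      fun i => QuotientGroup.mk'_surjective P _
    choose x hx using hx
    have hgen : closure (Set.range x) = ⊤ := by
      have hK : (closure (Set.range x)).map (QuotientGroup.mk' P) = ⊤ := by
        rw [MonoidHom.map_closure, ← Set.range_comp, ← hb]
        congr 2
        exact funext hx
      have hsup : closure (Set.range x) ⊔ P = ⊤ := by
        have h2 := comap_map_eq (QuotientGroup.mk' P) (closure (Set.range x))
        rw [hK, comap_top, QuotientGroup.ker_mk'] at h2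
        exact h2.symm
      rcases eq_top_or_exists_le_coatom (closure (Set.range x)) with h | ⟨M, hM, hle⟩
      · exact h
      · exfalso
        have := sup_le hle (coatom_le hp hG M hM)
        rw [← hP, hsup, top_le_iff] at this
        exact hM.1 this
    have h1 : minGens G ≤ (Finset.univ.image x).card :=
      Nat.sInf_le ⟨_, rfl, by simpa using hgen⟩
    refine h1.trans (Finset.card_image_le.trans ?_)
    simp

lemma two_le [Finite G] (hna : ∃ a b : G, a * b ≠ b * a) : 2 ≤ minGens G := by
  obtain ⟨S, hSc, hS⟩ := minGens_spec (G := G)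
  by_contra hlt
  have h1 : S.card ≤ 1 := by omega
  rw [Finset.card_le_one] at h1
  have s1 : ∀ a ∈ S, ∀ g : G, g * a = a * g := by
    intro a ha g
    have : (⊤ : Subgroup G) ≤ centralizer {a} := by
      rw [← hS, closure_le]
      intro b hb
      rw [SetLike.mem_coe, mem_centralizer_singleton_iff, h1 b hb a ha]
    exact mem_centralizer_singleton_iff.1 (this (mem_top g))
  obtain ⟨a, b, hab⟩ := hna
  have : (⊤ : Subgroup G) ≤ centralizer {b} := by
    rw [← hS, closure_le]
    intro c hc
    rw [SetLike.mem_coe, mem_centralizer_singleton_iff]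
    exact (s1 c hc b).symm
  exact hab (mem_centralizer_singleton_iff.1 (this (mem_top a)))

lemma upper {p n k : ℕ} (hp : p.Prime) [Finite G]
    (hG : Nat.card G = p ^ n) (hk : Nat.card (commutator G) = p ^ (k + 2))
    (hd : 4 ≤ minGens G) :
    schurCard G ^ 2 < p ^ ((minGens G - 1) * (n + k) + 2) := by
  set π : FreeGroup G →* G := FreeGroup.lift (id : G → G) with hπ
  have hs : Function.Surjective π := fun g => ⟨FreeGroup.of g, by simp [hπ]⟩
  have hmap : (commutator (FreeGroup G)).map π = commutator G := by
    rw [_root_.commutator_def, _root_.commutator_def, map_commutator,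
      Subgroup.map_top_of_surjective _ hs]
  have hR : π.ker.index = p ^ n := by
    rw [index_ker, MonoidHom.range_eq_top.2 hs, card_top, hG]
  have hRk : π.ker.relIndex (commutator (FreeGroup G)) = p ^ (k + 2) := by
    rw [relIndex_ker, hmap, hk]
  have hfr : (π.ker ⊔ commutator (FreeGroup G) ⊔
      closure (Set.range fun f : FreeGroup G => f ^ p)).index = p ^ minGens G := by
    rw [← burnside hp hG, ← index_comap_of_surjective _ hs]
    congr 1
    have h1 : commutator G ⊔ closure (Set.range fun f : G => f ^ p) =
        (commutator (FreeGroup G) ⊔ closure (Set.range fun f : FreeGroup G => f ^ p)).map π := by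
      rw [Subgroup.map_sup, hmap, MonoidHom.map_closure]
      congr 2
      ext g
      constructor
      · rintro ⟨f, rfl⟩
        obtain ⟨f, rfl⟩ := hs f
        exact ⟨f ^ p, ⟨f, rfl⟩, map_pow π f p⟩
      · rintro ⟨_, ⟨f, rfl⟩, rfl⟩
        exact ⟨π f, (map_pow π f p).symm⟩
    rw [h1, comap_map_eq, sup_assoc, sup_comm]
  have hmain := main_bound hp hd k n π.ker inferInstance hR hRk hfr
  have hle : ⁅π.ker, (⊤ : Subgroup (FreeGroup G))⁆ ≤ π.ker ⊓ commutator (FreeGroup G) :=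
    le_inf (commutator_le_left _ _) (comm_le_commutator _)
  have hsc : schurCard G =
      ⁅π.ker, (⊤ : Subgroup (FreeGroup G))⁆.relIndex (π.ker ⊓ commutator (FreeGroup G)) := rfl
  have hmul := relIndex_mul_relIndex _ _ _ hle (inf_le_right : π.ker ⊓ commutator (FreeGroup G) ≤ _)
  rw [← hsc, inf_relIndex_right, hRk] at hmul
  rw [← hmul, mul_pow, ← pow_mul, pow_add p _ (2 * (k + 2)), mul_comm (k + 2) 2] at hmain
  exact Nat.lt_of_mul_lt_mul_right hmain

end SchurAux

/-- If a non-abelian finite `p`-group `G` of order `p ^ n`, with commutator subgroup of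
order `p ^ k`, `k ≥ 2`, and `d = d(G)`, satisfies `|M(G)| = p ^ ((1/2)*(d-1)*(n+k-2)+1)`
(stated squared to avoid halves), then `2 ≤ d ≤ 3`. -/
theorem schur_bound_two_le_d_le_three
    {p n k d : ℕ} (hp : p.Prime) (G : Type*) [Group G] [Finite G]
    (hG : Nat.card G = p ^ n) (hna : ∃ a b : G, a * b ≠ b * a)
    (hk : Nat.card (commutator G) = p ^ k) (hk2 : 2 ≤ k)
    (hd : d = minGens G)
    (hM : schurCard G ^ 2 = p ^ ((d - 1) * (n + k - 2) + 2)) :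
    2 ≤ d ∧ d ≤ 3 := by

  subst hd
  refine ⟨SchurAux.two_le hna, ?_⟩
  by_contra h4
  obtain ⟨k, rfl⟩ : ∃ k', k = k' + 2 := ⟨k - 2, by omega⟩
  have h := SchurAux.upper hp hG hk (by omega)
  rw [hM, show n + (k + 2) - 2 = n + k by omega] at h
  exact lt_irrefl _ h
end
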